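/- arXiv:2302.11456 — 3 statements merged into one kernel-verified Lean document; each statement's English description precedes it below -/
import Mathlib

section
/- Let k be an algebraically closed field of characteristic not 2 with r+1 invertible, r even, and let A_r = k[[x,y]]/(y²−x^{r+1}). Then every non-trivial k-algebra involution of A_r is conjugate, by a k-algebra automorphism of A_r, to the involution defined by x ↦ x, y ↦ −y. -/
/-!
**Statement 1.** Let `k` be an algebraically closed field of characteristic not 2 with `r+1`
invertible, `r` even, and let `A_r = k[[x,y]]/(y²−x^{r+1})`. Then every non-trivial `k`-algebra
involution of `A_r` is conjugate, by a `k`-algebra automorphism of `A_r`, to the involution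
defined by `x ↦ x`, `y ↦ −y`.

We realize `A_r` as the quotient of the formal power series ring `k[[x,y]]` (in two variables)
by the ideal `(y² − x^{r+1})`; conjugacy is expressed on the topological generators `x`, `y`.
-/

noncomputable section

open MvPowerSeries

/-- The formal power series ring `k[[x,y]]` in two variables. -/
abbrev PS2 (k : Type*) [Field k] : Type _ := MvPowerSeries (Fin 2) k

/-- The complete local ring `A_r = k[[x,y]]/(y² − x^{r+1})` of an `A_r`-singularity. -/
abbrev ArRing (k : Type*) [Field k] (r : ℕ) : Type _ :=
  PS2 k ⧸ Ideal.span {(X (1 : Fin 2) : PS2 k) ^ 2 - (X (0 : Fin 2) : PS2 k) ^ (r + 1)}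

/-- The class of `x` in `A_r`. -/
def ArRing.x (k : Type*) [Field k] (r : ℕ) : ArRing k r :=
  Ideal.Quotient.mk _ (X (0 : Fin 2))

/-- The class of `y` in `A_r`. -/
def ArRing.y (k : Type*) [Field k] (r : ℕ) : ArRing k r :=
  Ideal.Quotient.mk _ (X (1 : Fin 2))

namespace ArAux

variable {k : Type*} [Field k]

/-- The substitution data `x ↦ t², y ↦ t^{r+1}`. -/
def sub (k : Type*) [Field k] (r : ℕ) : Fin 2 → MvPowerSeries Unit k :=
  ![(PowerSeries.X : PowerSeries k) ^ 2, (PowerSeries.X : PowerSeries k) ^ (r + 1)]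

theorem hasSubst_sub (r : ℕ) : HasSubst (sub k r) := by
  apply hasSubst_of_constantCoeff_zero
  intro s
  fin_cases s
  · change PowerSeries.constantCoeff ((PowerSeries.X : PowerSeries k) ^ 2) = 0
    simp
  · change PowerSeries.constantCoeff ((PowerSeries.X : PowerSeries k) ^ (r + 1)) = 0
    simp

/-- The parametrization `k[[x,y]] → k[[t]]`. -/
def psi (k : Type*) [Field k] (r : ℕ) : PS2 k →ₐ[k] PowerSeries k :=
  MvPowerSeries.substAlgHom (hasSubst_sub (k := k) r)

theorem psi_X0 (r : ℕ) : psi k r (X 0) = PowerSeries.X ^ 2 :=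
  MvPowerSeries.substAlgHom_X (hasSubst_sub (k := k) r) 0

theorem psi_X1 (r : ℕ) : psi k r (X 1) = PowerSeries.X ^ (r + 1) :=
  MvPowerSeries.substAlgHom_X (hasSubst_sub (k := k) r) 1

theorem prod_sub (r : ℕ) (d : Fin 2 →₀ ℕ) :
    (d.prod fun s e => (sub k r s) ^ e)
      = (PowerSeries.X : PowerSeries k) ^ (2 * d 0 + (r + 1) * d 1) := by
  rw [Finsupp.prod_fintype _ _ (by simp), Fin.prod_univ_two]
  change ((PowerSeries.X : PowerSeries k) ^ 2) ^ d 0 * ((PowerSeries.X : PowerSeries k) ^ (r + 1)) ^ d 1 = _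
  rw [← pow_mul, ← pow_mul, ← pow_add]

theorem coeff_psi (r : ℕ) (F : PS2 k) (n : ℕ) :
    PowerSeries.coeff n (psi k r F) =
      finsum (fun d : Fin 2 →₀ ℕ => if 2 * d 0 + (r + 1) * d 1 = n then coeff d F else 0) := by
  have h : psi k r F = subst (sub k r) F := by
    rw [psi, MvPowerSeries.coe_substAlgHom]
  rw [h]
  have := MvPowerSeries.coeff_subst (hasSubst_sub (k := k) r) F (Finsupp.single () n)
  refine this.trans (finsum_congr fun d => ?_)
  rw [prod_sub]
  have h2 : coeff (Finsupp.single () n) ((PowerSeries.X : PowerSeries k) ^ (2 * d 0 + (r + 1) * d 1))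
     = if n = 2 * d 0 + (r + 1) * d 1 then (1 : k) else 0 := PowerSeries.coeff_X_pow _ _
  rw [h2]
  by_cases hh : 2 * d 0 + (r + 1) * d 1 = n
  · simp [hh]
  · rw [if_neg hh, if_neg (Ne.symm hh), smul_zero]

/-- The exponent `(i, j)`. -/
def ex (i j : ℕ) : Fin 2 →₀ ℕ := Finsupp.single 0 i + Finsupp.single 1 j

@[simp] theorem ex0 (i j : ℕ) : ex i j 0 = i := by simp [ex]
@[simp] theorem ex1 (i j : ℕ) : ex i j 1 = j := by simp [ex]

theorem ex_eq (d : Fin 2 →₀ ℕ) : ex (d 0) (d 1) = d := by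
  ext s; fin_cases s <;> simp

theorem ext2 {d e : Fin 2 →₀ ℕ} (h0 : d 0 = e 0) (h1 : d 1 = e 1) : d = e := by
  ext s; fin_cases s <;> simpa

theorem coeff_psi_odd (r : ℕ) (F : PS2 k) (n : ℕ) (hn : Odd n) (hlt : n < r + 1) :
    PowerSeries.coeff n (psi k r F) = 0 := by
  rw [coeff_psi]
  apply finsum_eq_zero_of_forall_eq_zero
  intro d
  rw [if_neg]
  intro h
  rcases Nat.eq_zero_or_pos (d 1) with h1 | h1
  · rw [h1] at h; obtain ⟨l, hl⟩ := hn; omega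
  · nlinarith

theorem coeff_psi_even (r : ℕ) (hr : Even r) (F : PS2 k) (hF : ∀ i j, 2 ≤ j → coeff (ex i j) F = 0)
    (i : ℕ) : PowerSeries.coeff (2 * i) (psi k r F) = coeff (ex i 0) F := by
  rw [coeff_psi, finsum_eq_single _ (ex i 0)]
  · simp
  · intro d hd
    split_ifs with h
    · by_cases h2 : 2 ≤ d 1
      · rw [← ex_eq d]; exact hF _ _ h2
      · exfalso
        obtain ⟨m, rfl⟩ := hr
        have : d 1 = 0 ∨ d 1 = 1 := by omega
        rcases this with h1 | h1
        · apply hd; rw [h1] at h; apply ext2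
          · simp; omega
          · simpa
        · rw [h1] at h; omega
    · rfl

theorem coeff_psi_odd' (r : ℕ) (hr : Even r) (F : PS2 k)
    (hF : ∀ i j, 2 ≤ j → coeff (ex i j) F = 0)
    (i : ℕ) : PowerSeries.coeff (2 * i + (r + 1)) (psi k r F) = coeff (ex i 1) F := by
  rw [coeff_psi, finsum_eq_single _ (ex i 1)]
  · simp
  · intro d hd
    split_ifs with h
    · by_cases h2 : 2 ≤ d 1
      · rw [← ex_eq d]; exact hF _ _ h2
      · exfalso
        obtain ⟨m, rfl⟩ := hr
        have : d 1 = 0 ∨ d 1 = 1 := by omega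
        rcases this with h1 | h1
        · rw [h1] at h; omega
        · apply hd; rw [h1] at h; apply ext2
          · simp; omega
          · simpa
    · rfl

/-- coefficients of the quotient in the division by `y² - x^{r+1}`. -/
def quo (r : ℕ) (F : PS2 k) (i j : ℕ) : k :=
  coeff (ex i (j + 2)) F + if h : r + 1 ≤ i then quo r F (i - (r + 1)) (j + 2) else 0
termination_by i
decreasing_by omega

theorem exists_division (r : ℕ) (F : PS2 k) : ∃ G : PS2 k,
    ∀ i j, 2 ≤ j → coeff (ex i j) (F - (X 1 ^ 2 - X 0 ^ (r + 1)) * G) = 0 := by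
  refine ⟨fun d => quo r F (d 0) (d 1), fun i j hj => ?_⟩
  set G : PS2 k := fun d => quo r F (d 0) (d 1) with hG
  have hc : ∀ d, coeff d G = quo r F (d 0) (d 1) := fun d => rfl
  rw [sub_mul, map_sub, map_sub, X_pow_eq, X_pow_eq, coeff_monomial_mul, coeff_monomial_mul]
  obtain ⟨j, rfl⟩ := Nat.exists_eq_add_of_le hj
  rw [if_pos (by simp [Finsupp.single_le_iff])]
  simp only [hc, Finsupp.single_le_iff, one_mul, Finsupp.coe_tsub, Pi.sub_apply, ex0, ex1]
  rw [show (2 + j) = j + 2 by omega]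
  simp only [Finsupp.single_eq_same, Finsupp.single_apply]
  simp only [Fin.isValue, one_ne_zero, zero_ne_one, if_false, Nat.sub_zero,
    Nat.add_sub_cancel]
  rw [quo]
  split_ifs <;> ring

theorem ker_psi (r : ℕ) (hr : Even r) : RingHom.ker (psi k r) =
    Ideal.span {(X (1 : Fin 2) : PS2 k) ^ 2 - (X (0 : Fin 2) : PS2 k) ^ (r + 1)} := by
  have h0 : psi k r ((X (1 : Fin 2) : PS2 k) ^ 2 - (X (0 : Fin 2) : PS2 k) ^ (r + 1)) = 0 := by
    rw [map_sub, map_pow, map_pow, psi_X0, psi_X1]; ring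
  apply le_antisymm
  · intro F hF
    rw [RingHom.mem_ker] at hF
    obtain ⟨G, hG⟩ := exists_division r F
    have hR : psi k r (F - (X 1 ^ 2 - X 0 ^ (r + 1)) * G) = 0 := by
      rw [map_sub, map_mul, h0, hF]; simp
    have : F - (X 1 ^ 2 - X 0 ^ (r + 1)) * G = 0 := by
      ext d
      rw [← ex_eq d]
      by_cases h2 : 2 ≤ d 1
      · exact hG _ _ h2
      · have : d 1 = 0 ∨ d 1 = 1 := by omega
        rcases this with h1 | h1
        · rw [h1, ← coeff_psi_even r hr _ hG, hR]; simp
        · rw [h1, ← coeff_psi_odd' r hr _ hG, hR]; simp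
    rw [Ideal.mem_span_singleton]
    exact ⟨G, sub_eq_zero.mp this⟩
  · rw [Ideal.span_singleton_le_iff_mem]
    exact h0

theorem psi_surj (r : ℕ) (hr : Even r) (f : PowerSeries k)
    (hf : ∀ n, Odd n → n < r + 1 → PowerSeries.coeff n f = 0) : ∃ F, psi k r F = f := by
  let F : PS2 k := fun d => if d 1 = 0 then PowerSeries.coeff (2 * d 0) f
    else if d 1 = 1 then PowerSeries.coeff (2 * d 0 + (r + 1)) f else 0
  have hc : ∀ i j, coeff (ex i j) F = if j = 0 then PowerSeries.coeff (2 * i) f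
    else if j = 1 then PowerSeries.coeff (2 * i + (r + 1)) f else 0 := fun i j => by
      change F (ex i j) = _
      simp [F]
  have hF : ∀ i j, 2 ≤ j → coeff (ex i j) F = 0 := fun i j hj => by
    rw [hc, if_neg (by omega), if_neg (by omega)]
  refine ⟨F, ?_⟩
  ext n
  rcases Nat.even_or_odd n with h | h
  · obtain ⟨i, rfl⟩ := h.two_dvd
    rw [coeff_psi_even r hr F hF, hc]; simp
  · by_cases hlt : n < r + 1
    · rw [hf n h hlt, coeff_psi_odd r F n h hlt]
    · obtain ⟨i, rfl⟩ : ∃ i, n = 2 * i + (r + 1) := by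
        obtain ⟨l, rfl⟩ := h
        obtain ⟨m, rfl⟩ := hr
        exact ⟨l - m, by omega⟩
      rw [coeff_psi_odd' r hr F hF, hc]; simp

/-- The subalgebra `k[[t², t^{r+1}]]` of `k[[t]]`. -/
def B (k : Type*) [Field k] (r : ℕ) : Subalgebra k (PowerSeries k) where
  carrier := {f | PowerSeries.X ^ (r + 1) ∣ f - PowerSeries.rescale (-1) f}
  mul_mem' := by
    intro a b ha hb
    have : a * b - PowerSeries.rescale (-1) (a * b) =
      (a - PowerSeries.rescale (-1) a) * b
        + PowerSeries.rescale (-1) a * (b - PowerSeries.rescale (-1) b) := by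
      rw [map_mul]; ring
    simp only [Set.mem_ofPred_eq] at *
    rw [this]
    exact dvd_add (ha.mul_right _) (hb.mul_left _)
  add_mem' := by
    intro a b ha hb
    have : a + b - PowerSeries.rescale (-1) (a + b) =
      (a - PowerSeries.rescale (-1) a) + (b - PowerSeries.rescale (-1) b) := by
      rw [map_add]; ring
    simp only [Set.mem_ofPred_eq] at *
    rw [this]
    exact dvd_add ha hb
  algebraMap_mem' := by
    intro c
    have : PowerSeries.rescale (-1) (algebraMap k (PowerSeries k) c) = algebraMap k _ c := by
      ext n
      rw [PowerSeries.coeff_rescale, ← PowerSeries.C_eq_algebraMap, PowerSeries.coeff_C]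
      split_ifs with h <;> simp [h]
    simp only [Set.mem_ofPred_eq]
    rw [this, sub_self]
    exact dvd_zero _

theorem mem_B_dvd {r : ℕ} {f : PowerSeries k} :
    f ∈ B k r ↔ PowerSeries.X ^ (r + 1) ∣ f - PowerSeries.rescale (-1) f := Iff.rfl

theorem mem_B {r : ℕ} (h2 : (2 : k) ≠ 0) {f : PowerSeries k} :
    f ∈ B k r ↔ ∀ n, Odd n → n < r + 1 → PowerSeries.coeff n f = 0 := by
  rw [mem_B_dvd, PowerSeries.X_pow_dvd_iff]
  constructor
  · intro h n hn hlt
    have := h n hlt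
    rw [map_sub, PowerSeries.coeff_rescale, hn.neg_one_pow] at this
    have h3 : 2 * PowerSeries.coeff n f = 0 := by linear_combination this
    exact (mul_eq_zero.mp h3).resolve_left h2
  · intro h n hlt
    rw [map_sub, PowerSeries.coeff_rescale]
    rcases Nat.even_or_odd n with hn | hn
    · rw [hn.neg_one_pow]; ring
    · rw [h n hn hlt]; ring

theorem X_pow_mul_mem (r : ℕ) (f : PowerSeries k) : PowerSeries.X ^ (r + 1) * f ∈ B k r := by
  rw [mem_B_dvd, map_mul, map_pow, PowerSeries.rescale_neg_one_X, neg_pow]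
  exact dvd_sub (dvd_mul_right _ _) (Dvd.intro_left ((-1) ^ (r + 1) * PowerSeries.rescale (-1) f)
    (by ring))

theorem X_sq_mem (r : ℕ) : (PowerSeries.X : PowerSeries k) ^ 2 ∈ B k r := by
  rw [mem_B_dvd, map_pow, PowerSeries.rescale_neg_one_X]; simp

theorem X_pow_mem (r : ℕ) : (PowerSeries.X : PowerSeries k) ^ (r + 1) ∈ B k r := by
  simpa using X_pow_mul_mem r (1 : PowerSeries k)

/-- Composition with a power series without constant term. -/
def D (s : PowerSeries k) (hs : PowerSeries.constantCoeff s = 0) : PowerSeries k →ₐ[k] PowerSeries k :=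
  PowerSeries.substAlgHom (PowerSeries.HasSubst.of_constantCoeff_zero' hs)

theorem D_X (s : PowerSeries k) (hs : PowerSeries.constantCoeff s = 0) :
    D s hs PowerSeries.X = s := PowerSeries.substAlgHom_X _

theorem D_apply (s : PowerSeries k) (hs : PowerSeries.constantCoeff s = 0) (f : PowerSeries k) :
    D s hs f = f.subst s := by
  rw [D, PowerSeries.coe_substAlgHom]

theorem D_C (s : PowerSeries k) (hs : PowerSeries.constantCoeff s = 0) (c : k) :
    D s hs (PowerSeries.C c) = PowerSeries.C c := by
  rw [PowerSeries.C_eq_algebraMap, AlgHom.commutes]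

theorem cc_D (s : PowerSeries k) (hs : PowerSeries.constantCoeff s = 0) (f : PowerSeries k) :
    PowerSeries.constantCoeff (D s hs f) = PowerSeries.constantCoeff f := by
  have : PowerSeries.X ∣ f - PowerSeries.C (PowerSeries.constantCoeff f) := by
    rw [PowerSeries.X_dvd_iff]; simp
  obtain ⟨g, hg⟩ := this
  rw [sub_eq_iff_eq_add] at hg
  rw [hg, map_add, map_mul, D_X, D_C]; simp [hs]

theorem D_comp (s t : PowerSeries k) (hs : PowerSeries.constantCoeff s = 0)
    (ht : PowerSeries.constantCoeff t = 0) (f : PowerSeries k) :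
    D s hs (D t ht f) = D (D s hs t) (by rw [cc_D, ht]) f := by
  simp only [D_apply]
  exact PowerSeries.subst_comp_subst_apply (PowerSeries.HasSubst.of_constantCoeff_zero' ht)
    (PowerSeries.HasSubst.of_constantCoeff_zero' hs) f

theorem D_id (h) (f : PowerSeries k) : D (PowerSeries.X : PowerSeries k) h f = f := by
  rw [D_apply, PowerSeries.X_subst]

theorem trunc_eq (n : ℕ) (f : PowerSeries k) : (f.trunc n : PowerSeries k) =
    ∑ i ∈ Finset.range n, PowerSeries.C (PowerSeries.coeff i f) * PowerSeries.X ^ i := by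
  ext m
  rw [Polynomial.coeff_coe, PowerSeries.coeff_trunc, map_sum]
  simp only [PowerSeries.coeff_C_mul, PowerSeries.coeff_X_pow, mul_ite, mul_one, mul_zero]
  simp

theorem C_mem (r : ℕ) (c : k) : PowerSeries.C c ∈ B k r := by
  rw [PowerSeries.C_eq_algebraMap]; exact (B k r).algebraMap_mem c

theorem X_dvd_D {s : PowerSeries k} (hs : PowerSeries.constantCoeff s = 0) (n : ℕ)
    (f : PowerSeries k) : ∃ g, D s hs (PowerSeries.X ^ n * f) = PowerSeries.X ^ n * g := by
  obtain ⟨u, hu⟩ := PowerSeries.X_dvd_iff.mpr hs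
  refine ⟨u ^ n * D s hs f, ?_⟩
  rw [map_mul, map_pow, D_X]
  nth_rw 1 [hu]
  ring

theorem D_mem {r : ℕ} (h2 : (2 : k) ≠ 0) {s : PowerSeries k}
    (hs : PowerSeries.constantCoeff s = 0) (hsB : s ^ 2 ∈ B k r)
    {f : PowerSeries k} (hf : f ∈ B k r) : D s hs f ∈ B k r := by
  rw [f.eq_X_pow_mul_shift_add_trunc (r + 1), map_add]
  apply add_mem
  · obtain ⟨g, hg⟩ := X_dvd_D hs (r + 1) (PowerSeries.mk fun i ↦ PowerSeries.coeff (i + (r + 1)) f)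
    rw [hg]; exact X_pow_mul_mem r g
  · rw [trunc_eq, map_sum]
    apply sum_mem
    intro i hi
    rw [map_mul, D_C, map_pow, D_X]
    rcases Nat.even_or_odd i with h | h
    · obtain ⟨l, rfl⟩ := h.two_dvd
      rw [pow_mul]
      exact mul_mem (C_mem _ _) (pow_mem hsB l)
    · rw [(mem_B h2).mp hf i h (Finset.mem_range.mp hi)]
      simp

theorem mem_of_D_mem {r : ℕ} (h2 : (2 : k) ≠ 0) {s : PowerSeries k}
    (hs : PowerSeries.constantCoeff s = 0) (hs1 : PowerSeries.coeff 1 s ≠ 0)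
    (hsB : s ^ 2 ∈ B k r)
    {f : PowerSeries k} (hf : D s hs f ∈ B k r) : f ∈ B k r := by
  rw [mem_B h2]
  intro n
  induction n using Nat.strong_induction_on with
  | _ n ih =>
  intro hn hlt
  have hT : (f.trunc n : PowerSeries k) ∈ B k r := by
    rw [mem_B h2]
    intro j hj hlt'
    rw [Polynomial.coeff_coe, PowerSeries.coeff_trunc]
    split_ifs with h
    · exact ih j h hj hlt'
    · rfl
  have hf' := hf
  rw [f.eq_X_pow_mul_shift_add_trunc n, map_add] at hf'
  have h3 := (mem_B h2).mp ((add_mem_cancel_right (D_mem h2 hs hsB hT)).mp hf') n hn hlt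
  obtain ⟨u, hu⟩ := PowerSeries.X_dvd_iff.mpr hs
  rw [map_mul, map_pow, D_X] at h3
  nth_rw 1 [hu] at h3
  rw [mul_pow, mul_assoc, PowerSeries.coeff_X_pow_mul', if_pos le_rfl, Nat.sub_self,
    PowerSeries.coeff_zero_eq_constantCoeff_apply, map_mul, map_pow, cc_D] at h3
  have hu0 : PowerSeries.constantCoeff u ≠ 0 := by
    rw [hu, show (1 : ℕ) = 0 + 1 from rfl, PowerSeries.coeff_succ_X_mul] at hs1
    simpa using hs1
  have := (mul_eq_zero.mp h3).resolve_left (pow_ne_zero _ hu0)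
  simpa [← PowerSeries.coeff_zero_eq_constantCoeff_apply] using this

/-- The automorphism of `B` given by composition with `s`. -/
theorem exists_phi {r : ℕ} (h2 : (2 : k) ≠ 0) {s : PowerSeries k}
    (hs : PowerSeries.constantCoeff s = 0) (hs1 : PowerSeries.coeff 1 s ≠ 0)
    (hsB : s ^ 2 ∈ B k r) : ∃ φ : B k r ≃ₐ[k] B k r, ∀ f, (φ f : PowerSeries k) = D s hs f := by
  let p := s.substInvOfIsUnit (isUnit_iff_ne_zero.mpr hs1)
  have hp : PowerSeries.constantCoeff p = 0 := PowerSeries.constantCoeff_substInvOfIsUnit _ _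
  have h1 : D s hs p = PowerSeries.X := by
    rw [D_apply]; exact PowerSeries.subst_substInvOfIsUnit_left s hs _
  have h3 : D p hp s = PowerSeries.X := by
    rw [D_apply]; exact PowerSeries.subst_substInvOfIsUnit_right s hs _
  have hsp : ∀ f, D s hs (D p hp f) = f := fun f => by
    rw [D_comp]; simp only [h1, D_id]
  have hps : ∀ f, D p hp (D s hs f) = f := fun f => by
    rw [D_comp]; simp only [h3, D_id]
  let φ : B k r →ₐ[k] B k r := ((D s hs).comp (B k r).val).codRestrict (B k r)
    (fun f => D_mem h2 hs hsB f.2)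
  have hφ : ∀ f, (φ f : PowerSeries k) = D s hs f := fun f => rfl
  refine ⟨AlgEquiv.ofBijective φ ⟨?_, ?_⟩, hφ⟩
  · intro a b hab
    have : (φ a : PowerSeries k) = φ b := by rw [hab]
    rw [hφ, hφ] at this
    have := congrArg (D p hp) this
    rw [hps, hps] at this
    exact Subtype.ext this
  · intro b
    refine ⟨⟨D p hp b, mem_of_D_mem h2 hs hs1 hsB (by rw [hsp]; exact b.2)⟩, ?_⟩
    apply Subtype.ext
    rw [hφ]; exact hsp _

/-- `t²` in `B`. -/
def xB (k : Type*) [Field k] (r : ℕ) : B k r := ⟨_, X_sq_mem r⟩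

/-- `t^{r+1}` in `B`. -/
def yB (k : Type*) [Field k] (r : ℕ) : B k r := ⟨_, X_pow_mem r⟩

theorem inv_mem {r : ℕ} {f g : PowerSeries k} (hf : f ∈ B k r) (h : f * g = 1) : g ∈ B k r := by
  rw [mem_B_dvd] at *
  have h' : PowerSeries.rescale (-1) f * PowerSeries.rescale (-1) g = 1 := by
    rw [← map_mul, h, map_one]
  have : g - PowerSeries.rescale (-1) g = (f - PowerSeries.rescale (-1) f) *
      (-(g * PowerSeries.rescale (-1) g)) := by
    linear_combination (PowerSeries.rescale (-1) g) * h - g * h'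
  rw [this]
  exact hf.mul_right _

theorem isUnit_B {r : ℕ} (f : B k r) (h : PowerSeries.constantCoeff (f : PowerSeries k) ≠ 0) :
    IsUnit f := by
  have hu : IsUnit (f : PowerSeries k) := PowerSeries.isUnit_iff_constantCoeff.mpr
    (isUnit_iff_ne_zero.mpr h)
  obtain ⟨g, hg⟩ := hu.exists_right_inv
  exact IsUnit.of_mul_eq_one ⟨g, inv_mem f.2 hg⟩ (Subtype.ext hg)

theorem cc_sigma {r : ℕ} (σ : B k r ≃ₐ[k] B k r) (f : B k r)
    (h : PowerSeries.constantCoeff (f : PowerSeries k) = 0) :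
    PowerSeries.constantCoeff (σ f : PowerSeries k) = 0 := by
  by_contra hne
  have h1 := (isUnit_B _ hne).map σ.symm
  rw [AlgEquiv.symm_apply_apply] at h1
  have h3 := (h1.map (B k r).val).map PowerSeries.constantCoeff
  rw [Subalgebra.coe_val, h] at h3
  exact not_isUnit_zero h3

theorem exists_tau {r : ℕ} (hr : Even r) (σ : B k r ≃ₐ[k] B k r) :
    ∃ τ : PowerSeries k, PowerSeries.constantCoeff τ = 0 ∧
      (σ (xB k r) : PowerSeries k) = τ ^ 2 ∧ (σ (yB k r) : PowerSeries k) = τ ^ (r + 1) := by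
  obtain ⟨m, rfl⟩ := hr
  set x : PowerSeries k := (σ (xB k (m + m)) : PowerSeries k) with hx
  set y : PowerSeries k := (σ (yB k (m + m)) : PowerSeries k) with hy
  have hrel : y ^ 2 = x ^ (m + m + 1) := by
    have : yB k (m + m) ^ 2 = xB k (m + m) ^ (m + m + 1) := by
      apply Subtype.ext
      simp only [xB, yB, SubmonoidClass.mk_pow]
      ring
    have h := congrArg σ this
    rw [map_pow, map_pow] at h
    exact congrArg Subtype.val h
  have hx0 : x ≠ 0 := by
    intro h
    have : σ (xB k (m + m)) = 0 := Subtype.ext h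
    rw [map_eq_zero_iff σ σ.injective] at this
    have := congrArg Subtype.val this
    simp [xB] at this
  have hdvd : x ^ m ∣ y := by
    rw [← IsIntegrallyClosed.pow_dvd_pow_iff (n := 2) two_ne_zero, hrel]
    exact ⟨x, by ring⟩
  obtain ⟨τ, hτ⟩ := hdvd
  have h1 : x = τ ^ 2 := by
    have : x ^ (m + m) * x = x ^ (m + m) * τ ^ 2 := by
      rw [← pow_succ, ← hrel, hτ]; ring
    exact mul_left_cancel₀ (pow_ne_zero _ hx0) this
  refine ⟨τ, ?_, h1, ?_⟩
  · have := cc_sigma σ (xB k (m + m)) (by simp [xB])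
    rw [← hx, h1, map_pow] at this
    exact pow_eq_zero_iff two_ne_zero |>.mp this
  · rw [hτ, h1]; ring

theorem decomp {r : ℕ} (hr : Even r) (h2 : (2 : k) ≠ 0) (f : B k r) : ∃ (c d : k) (a : B k r),
    f = algebraMap k _ c + algebraMap k _ d * yB k r + xB k r * a := by
  obtain ⟨f, hf⟩ := f
  let a : PowerSeries k := PowerSeries.mk fun i => PowerSeries.coeff (i + 2) f -
    if i + 2 = r + 1 then PowerSeries.coeff (r + 1) f else 0
  rcases Nat.eq_zero_or_pos r with rfl | hpos
  · refine ⟨PowerSeries.coeff 0 f, PowerSeries.coeff 1 f, ⟨a, ?_⟩, ?_⟩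
    · rw [mem_B h2]; intro n hn hlt
      obtain ⟨l, hl⟩ := hn; omega
    · apply Subtype.ext
      change f = PowerSeries.C (PowerSeries.coeff 0 f)
        + PowerSeries.C (PowerSeries.coeff 1 f) * PowerSeries.X ^ (0 + 1) + PowerSeries.X ^ 2 * a
      ext n
      rw [map_add, map_add, PowerSeries.coeff_C, PowerSeries.coeff_C_mul, PowerSeries.coeff_X_pow,
        PowerSeries.coeff_X_pow_mul']
      rcases n with _ | _ | n
      · simp
      · simp
      · simp [a]
  · refine ⟨PowerSeries.coeff 0 f, PowerSeries.coeff (r + 1) f, ⟨a, ?_⟩, ?_⟩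
    · rw [mem_B h2] at *; intro n hn hlt
      simp only [a, PowerSeries.coeff_mk]
      split_ifs with h
      · rw [h]; ring
      · rw [hf]
        · simp
        · obtain ⟨l, rfl⟩ := hn; exact ⟨l + 1, by omega⟩
        · obtain ⟨l, rfl⟩ := hn; obtain ⟨m, rfl⟩ := hr; omega
    · apply Subtype.ext
      change f = PowerSeries.C (PowerSeries.coeff 0 f)
        + PowerSeries.C (PowerSeries.coeff (r + 1) f) * PowerSeries.X ^ (r + 1)
        + PowerSeries.X ^ 2 * a
      ext n
      rw [map_add, map_add, PowerSeries.coeff_C, PowerSeries.coeff_C_mul, PowerSeries.coeff_X_pow,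
        PowerSeries.coeff_X_pow_mul']
      rcases n with _ | _ | n
      · simp
      · rw [if_neg (by omega), if_neg (by omega), if_neg (by omega)]
        rw [(mem_B h2).mp hf _ ⟨0, by simp⟩ (by omega)]; simp
      · simp [a]

theorem sigma_eq {r : ℕ} (hr : Even r) (h2 : (2 : k) ≠ 0) (σ : B k r ≃ₐ[k] B k r)
    (τ : PowerSeries k) (hτ : PowerSeries.constantCoeff τ = 0)
    (hx : (σ (xB k r) : PowerSeries k) = τ ^ 2) (hy : (σ (yB k r) : PowerSeries k) = τ ^ (r + 1))
    (f : B k r) : (σ f : PowerSeries k) = D τ hτ f := by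
  have key : ∀ N : ℕ, ∀ f : B k r, PowerSeries.X ^ N ∣ (σ f : PowerSeries k) - D τ hτ f := by
    intro N
    induction N with
    | zero => intro f; simp
    | succ N ih =>
      intro f
      obtain ⟨c, d, a, hf⟩ := decomp hr h2 f
      obtain ⟨g, hg⟩ := ih a
      obtain ⟨u, hu⟩ := PowerSeries.X_dvd_iff.mpr hτ
      have e1 : (σ f : PowerSeries k) = algebraMap k _ c + algebraMap k _ d * τ ^ (r + 1)
          + τ ^ 2 * σ a := by
        rw [hf, map_add, map_add, map_mul, map_mul, AlgEquiv.commutes, AlgEquiv.commutes, ← hx, ← hy]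
        rfl
      have e2 : D τ hτ f = algebraMap k _ c + algebraMap k _ d * τ ^ (r + 1)
          + τ ^ 2 * D τ hτ a := by
        have : (f : PowerSeries k) = algebraMap k _ c
          + algebraMap k _ d * (PowerSeries.X : PowerSeries k) ^ (r + 1)
          + (PowerSeries.X : PowerSeries k) ^ 2 * a := by
          rw [hf]; rfl
        rw [this, map_add, map_add, map_mul, map_mul, AlgHom.commutes, AlgHom.commutes,
          map_pow, map_pow, D_X]
      refine ⟨PowerSeries.X * u ^ 2 * g, ?_⟩
      rw [e1, e2]
      linear_combination (τ ^ 2) * hg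
        + ((PowerSeries.X : PowerSeries k) ^ N * g) * (τ + (PowerSeries.X : PowerSeries k) * u) * hu
  ext n
  obtain ⟨g, hg⟩ := key (n + 1) f
  rw [sub_eq_iff_eq_add] at hg
  rw [hg, map_add, PowerSeries.coeff_X_pow_mul', if_neg (by omega), zero_add]

theorem main_B {r : ℕ} (hr : Even r) (h2 : (2 : k) ≠ 0) (σ : B k r ≃ₐ[k] B k r)
    (hinv : ∀ a, σ (σ a) = a) (hnt : ∃ a, σ a ≠ a) :
    ∃ φ : B k r ≃ₐ[k] B k r, σ (φ (xB k r)) = φ (xB k r) ∧ σ (φ (yB k r)) = - φ (yB k r) := by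
  obtain ⟨τ, hτ, hx, hy⟩ := exists_tau hr σ
  have hσ := sigma_eq hr h2 σ τ hτ hx hy
  set t : PowerSeries k := PowerSeries.X with ht
  have ht0 : t ≠ 0 := PowerSeries.X_ne_zero
  -- D τ τ = t
  have hττ : D τ hτ τ = t := by
    have e1 : (D τ hτ τ) ^ 2 = t ^ 2 := by
      have := congrArg Subtype.val (hinv (xB k r))
      rw [hσ, hx, map_pow] at this
      exact this
    have e2 : (D τ hτ τ) ^ (r + 1) = t ^ (r + 1) := by
      have := congrArg Subtype.val (hinv (yB k r))
      rw [hσ, hy, map_pow] at this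
      exact this
    obtain ⟨m, rfl⟩ := hr
    have e3 : (D τ hτ τ) ^ (m + m) = t ^ (m + m) := by
      rw [← two_mul, pow_mul, e1, ← pow_mul]
    rw [pow_succ, pow_succ, e3] at e2
    exact mul_left_cancel₀ (pow_ne_zero _ ht0) e2
  obtain ⟨u, hu⟩ := PowerSeries.X_dvd_iff.mpr hτ
  rw [← ht] at hu
  have hDt : D τ hτ t = τ := D_X τ hτ
  have huu : u * D τ hτ u = 1 := by
    have : t * (u * D τ hτ u) = t * 1 := by
      have h : D τ hτ (t * u) = t := by rw [← hu]; exact hττ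
      rw [map_mul, hDt] at h
      rw [mul_one, ← mul_assoc, ← hu]
      exact h
    exact mul_left_cancel₀ ht0 this
  set u0 := PowerSeries.constantCoeff u with hu0
  have hu0sq : u0 * u0 = 1 := by
    have := congrArg PowerSeries.constantCoeff huu
    rwa [map_mul, cc_D, map_one] at this
  have hcases : u0 = 1 ∨ u0 = -1 := mul_self_eq_one_iff.mp hu0sq
  rcases hcases with h1 | h1
  · exfalso
    -- τ = t
    have hτt : τ = t := by
      by_contra hne
      have hδ : τ - t ≠ 0 := sub_ne_zero.mpr hne
      obtain ⟨n, w, hw0, hw⟩ : ∃ (n : ℕ) (w : PowerSeries k),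
          PowerSeries.constantCoeff w ≠ 0 ∧ τ - t = t ^ n * w :=
        ⟨_, (τ - t).divXPowOrder, by
          have := PowerSeries.isUnit_divided_by_X_pow_order hδ
          exact (PowerSeries.isUnit_iff_constantCoeff.mp this).ne_zero,
          PowerSeries.X_pow_order_mul_divXPowOrder.symm⟩
      have hD : D τ hτ (τ - t) = -(τ - t) := by rw [map_sub, hττ, hDt]; ring
      rw [hw, map_mul, map_pow, hDt] at hD
      nth_rw 1 [hu] at hD
      have hD' : t ^ n * (u ^ n * D τ hτ w) = t ^ n * (-w) := by
        linear_combination hD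
      have := congrArg PowerSeries.constantCoeff (mul_left_cancel₀ (pow_ne_zero _ ht0) hD')
      rw [map_mul, map_pow, cc_D, ← hu0, h1, map_neg, one_pow, one_mul] at this
      have h3 : 2 * PowerSeries.constantCoeff w = 0 := by linear_combination this
      exact hw0 ((mul_eq_zero.mp h3).resolve_left h2)
    obtain ⟨a, ha⟩ := hnt
    apply ha
    apply Subtype.ext
    rw [hσ]
    subst hτt
    exact D_id _ _
  · let c : PowerSeries k := PowerSeries.C (2⁻¹ : k)
    have hc : 2 * c = 1 := by
      have : (2 : PowerSeries k) = PowerSeries.C (2 : k) := (map_ofNat _ 2).symm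
      rw [this, ← map_mul, mul_inv_cancel₀ h2, map_one]
    let s : PowerSeries k := c * (t - τ)
    have hs : PowerSeries.constantCoeff s = 0 := by
      simp [s, hτ, ht]
    have hs1 : PowerSeries.coeff 1 s ≠ 0 := by
      have : s = PowerSeries.X * (c * (1 - u)) := by
        simp only [s]; rw [← ht]; linear_combination (-c) * hu
      rw [this, show (1 : ℕ) = 0 + 1 from rfl, PowerSeries.coeff_succ_X_mul,
        PowerSeries.coeff_zero_eq_constantCoeff_apply]
      simp only [map_mul, map_sub, map_one, ← hu0, h1, c, PowerSeries.constantCoeff_C]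
      intro h
      apply one_ne_zero (α := k)
      rw [← h]; field_simp; ring
    have hDs : D τ hτ s = - s := by
      simp only [s, c]
      rw [map_mul, D_C, map_sub, hττ, hDt]; ring
    -- s ^ 2 ∈ B
    have htτ : t * τ ∈ B k r := by
      have h3 : τ ^ 2 ∈ B k r := by rw [← hx]; exact (σ (xB k r)).2
      rw [mem_B_dvd] at h3 ⊢
      set ρ : PowerSeries k →+* PowerSeries k := PowerSeries.rescale (-1) with hρ
      have hρt : ρ t = - t := PowerSeries.rescale_neg_one_X
      have hρu : PowerSeries.constantCoeff (ρ u) = -1 := by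
        rw [hρ, ← PowerSeries.coeff_zero_eq_constantCoeff_apply, PowerSeries.coeff_rescale]
        simp [← hu0, h1]
      have hρτ : ρ τ = - (t * ρ u) := by rw [hu, map_mul, hρt]; ring
      have hunit : IsUnit (u + ρ u) := by
        rw [PowerSeries.isUnit_iff_constantCoeff, map_add, ← hu0, h1, hρu, isUnit_iff_ne_zero]
        intro h; apply h2; linear_combination -h
      rw [map_mul, hρt]
      rw [← hunit.dvd_mul_right]
      have : (t * τ - -t * ρ τ) * (u + ρ u) = τ ^ 2 - ρ (τ ^ 2) := by
        rw [map_pow, hρτ, hu]; ring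
      rw [this]
      exact h3
    have hsB : s ^ 2 ∈ B k r := by
      have : s ^ 2 = c ^ 2 * (t ^ 2 + τ ^ 2 - 2 * (t * τ)) := by simp only [s]; ring
      rw [this]
      refine mul_mem (pow_mem (C_mem _ _) _) (sub_mem (add_mem (X_sq_mem r) ?_) (mul_mem ?_ htτ))
      · rw [← hx]; exact (σ (xB k r)).2
      · exact ofNat_mem (B k r) 2
    obtain ⟨φ, hφ⟩ := exists_phi h2 hs hs1 hsB
    have hφx : (φ (xB k r) : PowerSeries k) = s ^ 2 := by
      rw [hφ]; simp only [xB]; rw [map_pow, D_X]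
    have hφy : (φ (yB k r) : PowerSeries k) = s ^ (r + 1) := by
      rw [hφ]; simp only [yB]; rw [map_pow, D_X]
    refine ⟨φ, Subtype.ext ?_, Subtype.ext ?_⟩
    · rw [hσ, hφx, map_pow, hDs]; ring
    · rw [hσ, NegMemClass.coe_neg, hφy, map_pow, hDs, hr.add_one.neg_pow]

/-- `A_r ≃ B`. -/
theorem exists_equiv {r : ℕ} (hr : Even r) (h2 : (2 : k) ≠ 0) :
    ∃ e : ArRing k r ≃ₐ[k] B k r, e (ArRing.x k r) = xB k r ∧ e (ArRing.y k r) = yB k r := by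
  let ψ : PS2 k →ₐ[k] B k r := (psi k r).codRestrict (B k r) (fun F => by
    rw [mem_B h2]; exact coeff_psi_odd r F)
  have hψ : Function.Surjective ψ := by
    intro b
    obtain ⟨F, hF⟩ := psi_surj r hr (b : PowerSeries k) ((mem_B h2).mp b.2)
    exact ⟨F, Subtype.ext hF⟩
  have hker : Ideal.span {(X (1 : Fin 2) : PS2 k) ^ 2 - (X (0 : Fin 2) : PS2 k) ^ (r + 1)}
      = RingHom.ker ψ := by
    rw [← ker_psi r hr]
    ext F
    rw [RingHom.mem_ker, RingHom.mem_ker]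
    exact ⟨fun h => Subtype.ext h, fun h => congrArg Subtype.val h⟩
  refine ⟨(Ideal.quotientEquivAlgOfEq k hker).trans (Ideal.quotientKerAlgEquivOfSurjective hψ),
    ?_, ?_⟩
  · apply Subtype.ext
    exact psi_X0 r
  · apply Subtype.ext
    exact psi_X1 r

end ArAux

theorem stmt1 {k : Type*} [Field k] [IsAlgClosed k] (r : ℕ) (hr : Even r)
    (h2 : (2 : k) ≠ 0) (hr1 : ((r + 1 : ℕ) : k) ≠ 0)
    (σ : ArRing k r ≃ₐ[k] ArRing k r) (hinv : ∀ a, σ (σ a) = a)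
    (hnt : σ ≠ (AlgEquiv.refl : ArRing k r ≃ₐ[k] ArRing k r)) :
    ∃ φ : ArRing k r ≃ₐ[k] ArRing k r,
      ((φ.trans σ).trans φ.symm) (ArRing.x k r) = ArRing.x k r ∧
      ((φ.trans σ).trans φ.symm) (ArRing.y k r) = - ArRing.y k r := by
  obtain ⟨e, hex, hey⟩ := ArAux.exists_equiv (k := k) hr h2
  obtain ⟨φ, h1, h3⟩ := ArAux.main_B hr h2 ((e.symm.trans σ).trans e)
    (fun a => by simp [hinv])
    (by
      by_contra hcon
      push Not at hcon
      apply hnt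
      ext a
      have := hcon (e a)
      simpa using this)
  have h1' := congrArg e.symm h1
  have h3' := congrArg e.symm h3
  simp only [AlgEquiv.trans_apply, AlgEquiv.symm_apply_apply, map_neg] at h1' h3'
  refine ⟨(e.trans φ).trans e.symm, ?_, ?_⟩
  · rw [AlgEquiv.trans_apply, AlgEquiv.symm_apply_eq]
    simp only [AlgEquiv.trans_apply, hex, h1']
  · rw [AlgEquiv.trans_apply, AlgEquiv.symm_apply_eq]
    simp only [AlgEquiv.trans_apply, map_neg, hey, h3']
end
end

section
/- Let k be an algebraically closed field of characteristic not 2, r odd with r ≥ 3 and r+1 invertible in k, and A_r = k[[x,y]]/(y²−x^{r+1}). Then every non-trivial k-algebra involution of A_r is conjugate by an automorphism of A_r to exactly one of: (x,y) ↦ (x,−y), (x,y) ↦ (−x,y), or (x,y) ↦ (−x,−y). -/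
/-!
**Statement 2.** Let `k` be an algebraically closed field of characteristic not 2, `r` odd with
`r ≥ 3` and `r+1` invertible in `k`, and `A_r = k[[x,y]]/(y²−x^{r+1})`. Then every non-trivial
`k`-algebra involution of `A_r` is conjugate by an automorphism of `A_r` to exactly one of:
`(x,y) ↦ (x,−y)`, `(x,y) ↦ (−x,y)`, or `(x,y) ↦ (−x,−y)`.

We realize `A_r` as `k[[x,y]]/(y² − x^{r+1})`, and index the three standard involutions by
`i : Fin 3`: `i = 0` is `(x,−y)`, `i = 1` is `(−x,y)`, `i = 2` is `(−x,−y)`; "exactly one" is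
expressed by the unique existence of such an index.
-/

noncomputable section

open MvPowerSeries

/-- auxiliary division coefficients -/
def divAux {k : Type*} [Field k] (N : ℕ) (F : ℕ → ℕ → k) (i j : ℕ) : k :=
  F i (j + 2) + if h : 1 ≤ N ∧ N ≤ i then divAux N F (i - N) (j + 2) else 0
termination_by i
decreasing_by omega

lemma ps2_div {k : Type*} [Field k] (N : ℕ) (hN : 1 ≤ N) (F : PS2 k) :
    ∃ (G : PS2 k) (P Q : PowerSeries k),
      F = (X (1 : Fin 2) ^ 2 - X (0 : Fin 2) ^ N) * G + P.subst (X (0 : Fin 2) : PS2 k)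
        + X (1 : Fin 2) ^ 1 * Q.subst (X (0 : Fin 2) : PS2 k) := by
  classical
  let c : ℕ → ℕ → k := fun i j => coeff (Finsupp.single 0 i + Finsupp.single 1 j) F
  let G : PS2 k := fun e => divAux N c (e 0) (e 1)
  have hG : ∀ e, coeff e G = divAux N c (e 0) (e 1) := fun e => rfl
  refine ⟨G, PowerSeries.mk fun i => c i 0 + if N ≤ i then divAux N c (i - N) 0 else 0,
    PowerSeries.mk fun i => c i 1 + if N ≤ i then divAux N c (i - N) 1 else 0, ?_⟩
  have hF : ∀ e : Fin 2 →₀ ℕ, coeff e F = c (e 0) (e 1) := by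
    intro e
    have : e = Finsupp.single 0 (e 0) + Finsupp.single 1 (e 1) := by
      ext i; fin_cases i <;> simp
    simp only [c]; rw [← this]
  have hle : ∀ (s : Fin 2) (m : ℕ) (e : Fin 2 →₀ ℕ), Finsupp.single s m ≤ e ↔ m ≤ e s := by
    intro s m e; simp
  ext e
  have hs : ∀ e : Fin 2 →₀ ℕ, e = Finsupp.single 0 (e 0) ↔ e 1 = 0 := by
    intro e
    constructor
    · intro h; rw [h]; simp
    · intro h; ext i; fin_cases i <;> simp [h]
  simp only [map_add, sub_mul, map_sub, X_pow_eq, coeff_monomial_mul, hle, one_mul, hG, hF,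
    PowerSeries.coeff_subst_single, hs, PowerSeries.coeff_mk]
  simp only [Finsupp.coe_tsub, Pi.sub_apply, Finsupp.single_apply]
  simp
  generalize e 0 = i
  generalize e 1 = j
  rcases j with _ | _ | j
  · simp
  · simp
  · simp
    rw [divAux]
    simp [hN]

structure NodeModel (k : Type*) [Field k] (A : Type*) [CommRing A] [Algebra k A] (n : ℕ) where
  ι : A →ₐ[k] PowerSeries k × PowerSeries k
  D : PowerSeries k →ₐ[k] A
  x : A
  y : A
  inj : Function.Injective ι
  ιD : ∀ P, ι (D P) = (P, P)
  DX : D PowerSeries.X = x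
  ιy : ι y = (PowerSeries.X ^ n, - PowerSeries.X ^ n)
  span : ∀ a, ∃ P Q, a = D P + y * D Q

lemma hasSubst_ev {k : Type*} [Field k] (n : ℕ) (hn : 1 ≤ n) (ε : k) :
    HasSubst (![PowerSeries.X, PowerSeries.C ε * PowerSeries.X ^ n] : Fin 2 → PowerSeries k) := by
  apply hasSubst_of_constantCoeff_zero
  intro s
  fin_cases s
  · exact PowerSeries.constantCoeff_X
  · change PowerSeries.constantCoeff (PowerSeries.C ε * PowerSeries.X ^ n) = 0
    simp; omega

/-- evaluation on a branch -/
def evB {k : Type*} [Field k] (n : ℕ) (hn : 1 ≤ n) (ε : k) : PS2 k →ₐ[k] PowerSeries k :=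
  substAlgHom (hasSubst_ev n hn ε)

lemma evB_X0 {k : Type*} [Field k] (n : ℕ) (hn : 1 ≤ n) (ε : k) :
    evB n hn ε (X 0) = PowerSeries.X := substAlgHom_X _ _

lemma evB_X1 {k : Type*} [Field k] (n : ℕ) (hn : 1 ≤ n) (ε : k) :
    evB n hn ε (X 1) = PowerSeries.C ε * PowerSeries.X ^ n := substAlgHom_X _ _

lemma evB_D {k : Type*} [Field k] (n : ℕ) (hn : 1 ≤ n) (ε : k) (P : PowerSeries k) :
    evB n hn ε (P.subst (X 0 : PS2 k)) = P := by
  have h1 : evB n hn ε (P.subst (X 0 : PS2 k)) =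
    subst (![PowerSeries.X, PowerSeries.C ε * PowerSeries.X ^ n] : Fin 2 → PowerSeries k)
      (subst (fun _ : Unit => (X 0 : PS2 k)) P) := by
    rw [evB, coe_substAlgHom]; rfl
  rw [h1, subst_comp_subst_apply (PowerSeries.HasSubst.X (0 : Fin 2)).const (hasSubst_ev n hn ε)]
  conv_rhs => rw [← PowerSeries.X_subst P]
  rw [PowerSeries.subst_def]
  congr 1
  funext _
  rw [subst_X (hasSubst_ev n hn ε)]
  rfl

/-- The model for `A_r` -/
theorem nodeModel {k : Type*} [Field k] (h2 : (2 : k) ≠ 0) (r n : ℕ) (hn : 1 ≤ n)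
    (hrn : r + 1 = 2 * n) :
    ∃ M : NodeModel k (ArRing k r) n, M.x = ArRing.x k r ∧ M.y = ArRing.y k r := by
  let ι0 : PS2 k →ₐ[k] PowerSeries k × PowerSeries k := (evB n hn 1).prod (evB n hn (-1))
  have hι0 : ∀ f, ι0 f = (evB n hn 1 f, evB n hn (-1) f) := fun f => rfl
  have hker : ∀ a ∈ Ideal.span {(X (1 : Fin 2) : PS2 k) ^ 2 - (X (0 : Fin 2) : PS2 k) ^ (r + 1)},
      ι0 a = 0 := by
    intro a ha
    rw [Ideal.mem_span_singleton] at ha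
    obtain ⟨b, rfl⟩ := ha
    have : ι0 (X 1 ^ 2 - X 0 ^ (r + 1)) = 0 := by
      rw [hι0]
      simp only [map_sub, map_pow, evB_X0, evB_X1, hrn, Prod.mk_eq_zero, map_neg, map_one]
      constructor <;> ring
    rw [map_mul, this, zero_mul]
  let ι : ArRing k r →ₐ[k] PowerSeries k × PowerSeries k := Ideal.Quotient.liftₐ _ ι0 hker
  let mk : PS2 k →ₐ[k] ArRing k r := Ideal.Quotient.mkₐ k _
  have hιmk : ∀ f, ι (mk f) = ι0 f := fun f => rfl
  let D0 : PowerSeries k →ₐ[k] PS2 k := PowerSeries.substAlgHom (PowerSeries.HasSubst.X (0 : Fin 2))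
  have hD0 : ∀ P, D0 P = P.subst (X 0 : PS2 k) := fun P => by
    simp only [D0, PowerSeries.coe_substAlgHom]
  have hspan : ∀ a, ∃ P Q, a = mk (D0 P) + ArRing.y k r * mk (D0 Q) := by
    intro a
    obtain ⟨F, rfl⟩ := Ideal.Quotient.mk_surjective a
    obtain ⟨G, P, Q, h⟩ := ps2_div (r + 1) (by omega) F
    refine ⟨P, Q, ?_⟩
    change mk F = mk (D0 P) + mk (X 1) * mk (D0 Q)
    have h0 : mk (X (1 : Fin 2) ^ 2 - X (0 : Fin 2) ^ (r + 1)) = 0 :=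
      Ideal.Quotient.eq_zero_iff_mem.2 (Ideal.mem_span_singleton_self _)
    rw [h, hD0, hD0, pow_one, map_add, map_add, map_mul, map_mul, h0, zero_mul, zero_add]
  have hιD : ∀ P, ι (mk (D0 P)) = (P, P) := by
    intro P
    rw [hιmk, hι0, hD0, evB_D, evB_D]
  have hιy : ι (ArRing.y k r) = (PowerSeries.X ^ n, - PowerSeries.X ^ n) := by
    change ι (mk (X 1)) = _
    rw [hιmk, hι0, evB_X1, evB_X1]
    simp
  have hinj : Function.Injective ι := by
    rw [injective_iff_map_eq_zero]
    intro a ha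
    obtain ⟨P, Q, rfl⟩ := hspan a
    rw [map_add, map_mul, hιD, hιD, hιy] at ha
    simp only [Prod.mk_mul_mk, Prod.mk_add_mk, Prod.mk_eq_zero] at ha
    obtain ⟨h1, h3⟩ := ha
    have h2' : (2 : PowerSeries k) ≠ 0 := by
      intro h
      apply h2
      have := congrArg PowerSeries.constantCoeff h
      rwa [map_ofNat, map_zero] at this
    have hP : P = 0 := by
      have : 2 * P = 0 := by linear_combination h1 + h3
      exact (mul_eq_zero.1 this).resolve_left h2'
    have hQ : Q = 0 := by
      rw [hP, zero_add] at h1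
      exact (mul_eq_zero.1 h1).resolve_left (pow_ne_zero _ PowerSeries.X_ne_zero)
    rw [hP, hQ]; simp
  refine ⟨⟨ι, mk.comp D0, ArRing.x k r, ArRing.y k r, hinj, hιD, ?_, hιy, hspan⟩, rfl, rfl⟩
  change mk (D0 _) = mk (X 0)
  rw [hD0, PowerSeries.subst_X (PowerSeries.HasSubst.X (0 : Fin 2))]

namespace NodeModel

open PowerSeries in
lemma ps_two {k : Type*} [Field k] (h2 : (2 : k) ≠ 0) : (2 : PowerSeries k) ≠ 0 := by
  intro h
  apply h2
  have := congrArg (PowerSeries.constantCoeff (R := k)) h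
  rwa [map_ofNat, map_zero] at this

lemma dvd_coeff {k : Type*} [Field k] {n m : ℕ} (hm : m < n) {f g : PowerSeries k}
    (h : PowerSeries.X ^ n ∣ f - g) : PowerSeries.coeff m f = PowerSeries.coeff m g := by
  have := PowerSeries.X_pow_dvd_iff.1 h m hm
  rw [map_sub] at this
  exact sub_eq_zero.1 this

lemma half {k : Type*} [Field k] (h2 : (2 : k) ≠ 0) : 2 * PowerSeries.C (2⁻¹ : k) = 1 := by
  rw [← map_ofNat (PowerSeries.C (R := k)) 2, ← map_mul, mul_inv_cancel₀ h2, map_one]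

/-- substitution respects congruences mod `X ^ n` -/
lemma subst_congr {k : Type*} [Field k] {n : ℕ} {f g a b : PowerSeries k}
    (ha : PowerSeries.constantCoeff a = 0) (hb : PowerSeries.constantCoeff b = 0)
    (hfg : PowerSeries.X ^ n ∣ f - g) (hab : PowerSeries.X ^ n ∣ a - b) :
    PowerSeries.X ^ n ∣ f.subst a - g.subst b := by
  have hsa := PowerSeries.HasSubst.of_constantCoeff_zero' ha
  have hsb := PowerSeries.HasSubst.of_constantCoeff_zero' hb
  have key : ∀ (c : PowerSeries k) (hc : PowerSeries.constantCoeff c = 0) (h : PowerSeries k),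
      PowerSeries.X ^ n ∣ h → PowerSeries.X ^ n ∣ h.subst c := by
    rintro c hc _ ⟨h, rfl⟩
    have hsc := PowerSeries.HasSubst.of_constantCoeff_zero' hc
    rw [PowerSeries.subst_mul hsc, PowerSeries.subst_pow hsc, PowerSeries.subst_X hsc]
    exact Dvd.dvd.mul_right (pow_dvd_pow_of_dvd (PowerSeries.X_dvd_iff.2 hc) n) _
  have h1 : PowerSeries.X ^ n ∣ f.subst a - g.subst a := by
    rw [← PowerSeries.subst_sub hsa]
    exact key a ha _ hfg
  have ht : PowerSeries.X ^ n ∣ g - (PowerSeries.trunc n g : PowerSeries k) := by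
    rw [PowerSeries.X_pow_dvd_iff]
    intro m hm
    rw [map_sub, PowerSeries.coeff_coe_trunc_of_lt hm, sub_self]
  have h3 := key a ha _ ht
  have h4 := key b hb _ ht
  rw [PowerSeries.subst_sub hsa, PowerSeries.subst_coe hsa] at h3
  rw [PowerSeries.subst_sub hsb, PowerSeries.subst_coe hsb] at h4
  have h5 : PowerSeries.X ^ n ∣ Polynomial.aeval a (PowerSeries.trunc n g)
      - Polynomial.aeval b (PowerSeries.trunc n g) := by
    rw [Polynomial.aeval_def, Polynomial.aeval_def, Polynomial.eval₂_eq_eval_map,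
      Polynomial.eval₂_eq_eval_map]
    exact hab.trans (Polynomial.sub_dvd_eval_sub a b _)
  have := dvd_sub (dvd_add (dvd_add h1 h3) h5) h4
  convert this using 1
  ring

variable {k : Type*} [Field k] {A : Type*} [CommRing A] [Algebra k A] {n : ℕ}

lemma ιx (M : NodeModel k A n) : M.ι M.x = (PowerSeries.X, PowerSeries.X) := by
  rw [← M.DX, M.ιD]

lemma lift (M : NodeModel k A n) (h2 : (2 : k) ≠ 0) (f g : PowerSeries k)
    (h : PowerSeries.X ^ n ∣ f - g) : ∃ a, M.ι a = (f, g) := by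
  obtain ⟨q, hq⟩ := h
  have hh := half h2
  refine ⟨M.D (PowerSeries.C 2⁻¹ * (f + g)) + M.y * M.D (PowerSeries.C 2⁻¹ * q), ?_⟩
  rw [map_add, map_mul M.ι, M.ιD, M.ιD, M.ιy]
  simp only [Prod.mk_mul_mk, Prod.mk_add_mk, Prod.mk.injEq]
  constructor
  · linear_combination f * hh - PowerSeries.C 2⁻¹ * hq
  · linear_combination g * hh + PowerSeries.C 2⁻¹ * hq

lemma mem (M : NodeModel k A n) (a : A) : PowerSeries.X ^ n ∣ (M.ι a).1 - (M.ι a).2 := by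
  obtain ⟨P, Q, rfl⟩ := M.span a
  rw [map_add, map_mul, M.ιD, M.ιD, M.ιy]
  refine ⟨2 * Q, ?_⟩
  simp only [Prod.mk_mul_mk, Prod.mk_add_mk]
  ring

lemma rel (M : NodeModel k A n) : M.y ^ 2 = M.x ^ (2 * n) := by
  apply M.inj
  rw [map_pow, map_pow, M.ιx, M.ιy]
  simp only [Prod.pow_mk, Prod.mk.injEq]
  constructor <;> ring

/-- constant coefficient -/
def c0 (M : NodeModel k A n) (a : A) : k := PowerSeries.constantCoeff (M.ι a).1

/-- linear coefficient -/
def lin (M : NodeModel k A n) (a : A) : k := PowerSeries.coeff 1 (M.ι a).1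

lemma c0_snd (M : NodeModel k A n) (hn : 2 ≤ n) (a : A) :
    PowerSeries.constantCoeff (M.ι a).2 = M.c0 a := by
  have := dvd_coeff (m := 0) (by omega) (M.mem a)
  simpa [c0] using this.symm

lemma lin_snd (M : NodeModel k A n) (hn : 2 ≤ n) (a : A) :
    PowerSeries.coeff 1 (M.ι a).2 = M.lin a :=
  (dvd_coeff (m := 1) (by omega) (M.mem a)).symm

lemma isUnit_of_c0 (M : NodeModel k A n) (h2 : (2 : k) ≠ 0) (hn : 2 ≤ n) (a : A)
    (ha : M.c0 a ≠ 0) : IsUnit a := by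
  have h1 : (M.ι a).1 * (M.ι a).1⁻¹ = 1 := PowerSeries.mul_inv_cancel _ ha
  have h3 : (M.ι a).2 * (M.ι a).2⁻¹ = 1 :=
    PowerSeries.mul_inv_cancel _ (by rw [M.c0_snd hn]; exact ha)
  obtain ⟨b, hb⟩ := M.lift h2 (M.ι a).1⁻¹ (M.ι a).2⁻¹ (by
    have : (M.ι a).1⁻¹ - (M.ι a).2⁻¹ =
        ((M.ι a).1 - (M.ι a).2) * (-((M.ι a).1⁻¹ * (M.ι a).2⁻¹)) := by
      linear_combination (M.ι a).2⁻¹ * h1 - (M.ι a).1⁻¹ * h3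
    rw [this]
    exact Dvd.dvd.mul_right (M.mem a) _)
  refine IsUnit.of_mul_eq_one b (M.inj ?_)
  rw [map_mul, hb, map_one]
  exact Prod.ext h1 h3

lemma ι_alg (M : NodeModel k A n) (c : k) :
    M.ι (algebraMap k A c) = (PowerSeries.C c, PowerSeries.C c) := by
  rw [AlgHom.commutes]; rfl

lemma c0_map (M : NodeModel k A n) (h2 : (2 : k) ≠ 0) (hn : 2 ≤ n) (s : A →ₐ[k] A) (w : A)
    (hw : M.c0 w = 0) : M.c0 (s w) = 0 := by
  by_contra hd
  have hu : IsUnit (w - algebraMap k A (M.c0 (s w))) := by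
    apply M.isUnit_of_c0 h2 hn
    rw [c0, map_sub, ι_alg, Prod.fst_sub, map_sub, PowerSeries.constantCoeff_C]
    change M.c0 w - _ ≠ 0
    rw [hw, zero_sub]
    exact neg_ne_zero.2 hd
  have h3 := (((hu.map s).map M.ι).map (RingHom.fst _ _)).map (PowerSeries.constantCoeff (R := k))
  apply h3.ne_zero
  rw [map_sub, AlgHom.commutes, map_sub, ι_alg]
  simp [c0]

lemma lin_map (M : NodeModel k A n) (h2 : (2 : k) ≠ 0) (hn : 2 ≤ n) (s : A →ₐ[k] A) (w : A)
    (hw : M.c0 w = 0) : M.lin (s w) = M.lin w * M.lin (s M.x) := by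
  obtain ⟨P, Q, rfl⟩ := M.span w
  have hX2 : PowerSeries.X ^ 2 ∣ (PowerSeries.X : PowerSeries k) ^ n * Q :=
    Dvd.dvd.mul_right (pow_dvd_pow _ hn) _
  have hι : (M.ι (M.D P + M.y * M.D Q)).1 = P + PowerSeries.X ^ n * Q := by
    rw [map_add, map_mul, M.ιD, M.ιD, M.ιy]; rfl
  have hP0 : PowerSeries.coeff 0 P = 0 := by
    have h0 := PowerSeries.X_pow_dvd_iff.1 hX2 0 (by omega)
    rw [c0, hι, map_add] at hw
    rw [PowerSeries.coeff_zero_eq_constantCoeff_apply] at h0 ⊢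
    rwa [h0, add_zero] at hw
  have hP1 : M.lin (M.D P + M.y * M.D Q) = PowerSeries.coeff 1 P := by
    rw [lin, hι, map_add, PowerSeries.X_pow_dvd_iff.1 hX2 1 (by omega), add_zero]
  have hdec : PowerSeries.X ^ 2 ∣ P - PowerSeries.C (PowerSeries.coeff 1 P) * PowerSeries.X := by
    rw [PowerSeries.X_pow_dvd_iff]
    intro m hm
    interval_cases m
    · simp only [map_sub, hP0]; simp
    · rw [map_sub, PowerSeries.coeff_C_mul]; simp
  obtain ⟨P2, hP2⟩ := hdec
  have hPe : M.D P = algebraMap k A (PowerSeries.coeff 1 P) * M.x + M.x ^ 2 * M.D P2 := by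
    rw [sub_eq_iff_eq_add] at hP2
    conv_lhs => rw [hP2]
    rw [map_add, map_mul, map_mul, map_pow, M.DX, add_comm]
    congr 2
    exact M.D.commutes _
  have hxc : M.c0 (s M.x) = 0 := M.c0_map h2 hn s _ (by rw [c0, M.ιx]; simp)
  have hsx : PowerSeries.X ∣ (M.ι (s M.x)).1 := PowerSeries.X_dvd_iff.2 hxc
  have hsy : PowerSeries.X ^ n ∣ (M.ι (s M.y)).1 := by
    have h := congrArg (fun a => (M.ι (s a)).1) M.rel
    simp only [map_pow, Prod.pow_fst] at h
    rw [← IsIntegrallyClosed.pow_dvd_pow_iff (n := 2) (by norm_num), h, ← pow_mul, mul_comm n 2]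
    exact pow_dvd_pow_of_dvd hsx _
  rw [hP1, hPe]
  simp only [lin, map_add, map_mul, map_pow, AlgHom.commutes, Prod.fst_add, Prod.fst_mul,
    Prod.pow_fst]
  have e1 : PowerSeries.coeff 1 ((M.ι (s M.x)).1 ^ 2 * (M.ι (s (M.D P2))).1) = 0 :=
    PowerSeries.X_pow_dvd_iff.1 (Dvd.dvd.mul_right (pow_dvd_pow_of_dvd hsx 2) _) 1 (by omega)
  have e2 : PowerSeries.coeff 1 ((M.ι (s M.y)).1 * (M.ι (s (M.D Q))).1) = 0 :=
    PowerSeries.X_pow_dvd_iff.1 (Dvd.dvd.mul_right ((pow_dvd_pow _ hn).trans hsy) _) 1 (by omega)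
  rw [e1, e2, add_zero, add_zero]
  exact PowerSeries.coeff_C_mul _ _ _

lemma hext (M : NodeModel k A n) (s : A →ₐ[k] A) (hx : s M.x = M.x) (hy : s M.y = M.y) (a : A) :
    s a = a := by
  have hD : ∀ P, s (M.D P) = M.D P := by
    intro P
    apply M.inj
    have key : ∀ N, ∃ b, M.ι (s (M.D P)) - M.ι (M.D P) =
        (PowerSeries.X ^ N * (M.ι b).1, PowerSeries.X ^ N * (M.ι b).2) := by
      intro N
      have ht : PowerSeries.X ^ N ∣ P - (PowerSeries.trunc N P : PowerSeries k) := by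
        rw [PowerSeries.X_pow_dvd_iff]
        intro m hm
        rw [map_sub, PowerSeries.coeff_coe_trunc_of_lt hm, sub_self]
      obtain ⟨P', hP'⟩ := ht
      have hpol : ∀ p : Polynomial k, s (M.D (p : PowerSeries k)) = M.D (p : PowerSeries k) := by
        intro p
        have h1 : M.D (p : PowerSeries k) = Polynomial.aeval M.x p := by
          have : (p : PowerSeries k) = Polynomial.aeval PowerSeries.X p := by
            rw [← PowerSeries.subst_coe PowerSeries.HasSubst.X', PowerSeries.X_subst]
          rw [this, ← Polynomial.aeval_algHom_apply, M.DX]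
        rw [h1, ← Polynomial.aeval_algHom_apply, hx]
      refine ⟨s (M.D P') - M.D P', ?_⟩
      rw [sub_eq_iff_eq_add] at hP'
      have h3 : s (M.D P) - M.D P = M.x ^ N * (s (M.D P') - M.D P') := by
        rw [hP', map_add, map_add, hpol, map_mul, map_mul, map_pow, map_pow, M.DX, hx]; ring
      rw [← map_sub, h3, map_mul, map_pow, M.ιx]
      rfl
    have h1 : (M.ι (s (M.D P)) - M.ι (M.D P)).1 = 0 := by
      ext N
      obtain ⟨b, hb⟩ := key (N + 1)
      rw [hb]
      exact PowerSeries.X_pow_dvd_iff.1 (dvd_mul_right _ _) N (by omega)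
    have h2 : (M.ι (s (M.D P)) - M.ι (M.D P)).2 = 0 := by
      ext N
      obtain ⟨b, hb⟩ := key (N + 1)
      rw [hb]
      exact PowerSeries.X_pow_dvd_iff.1 (dvd_mul_right _ _) N (by omega)
    exact sub_eq_zero.1 (Prod.ext h1 h2)
  obtain ⟨P, Q, rfl⟩ := M.span a
  rw [map_add, map_mul, hD, hD, hy]

/-- substitution automorphism -/
lemma exists_subst_equiv (a : PowerSeries k) (ha : PowerSeries.constantCoeff a = 0)
    (ha1 : PowerSeries.coeff 1 a ≠ 0) :
    ∃ b : PowerSeries k, PowerSeries.constantCoeff b = 0 ∧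
      (∀ f : PowerSeries k, PowerSeries.subst b (PowerSeries.subst a f) = f) ∧
      (∀ f : PowerSeries k, PowerSeries.subst a (PowerSeries.subst b f) = f) := by
  have hu : IsUnit (PowerSeries.coeff 1 a) := ha1.isUnit
  have hsa := PowerSeries.HasSubst.of_constantCoeff_zero' ha
  have hb0 : PowerSeries.constantCoeff (a.substInvOfIsUnit hu) = 0 := by simp
  have hsb := PowerSeries.HasSubst.of_constantCoeff_zero' hb0
  refine ⟨a.substInvOfIsUnit hu, hb0, ?_, ?_⟩
  · intro f
    rw [PowerSeries.subst_comp_subst_apply hsa hsb,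
      PowerSeries.subst_substInvOfIsUnit_right _ ha hu, PowerSeries.X_subst]
  · intro f
    rw [PowerSeries.subst_comp_subst_apply hsb hsa,
      PowerSeries.subst_substInvOfIsUnit_left _ ha hu, PowerSeries.X_subst]

lemma exists_aut (M : NodeModel k A n) (h2 : (2 : k) ≠ 0) (hn : 2 ≤ n) (u : A)
    (hu0 : M.c0 u = 0) (hu1 : M.lin u ≠ 0) : ∃ φ : A ≃ₐ[k] A, φ M.x = u := by
  have ha0 : PowerSeries.constantCoeff (M.ι u).1 = 0 := hu0
  have hb0 : PowerSeries.constantCoeff (M.ι u).2 = 0 := by rw [M.c0_snd hn, hu0]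
  have ha1 : PowerSeries.coeff 1 (M.ι u).1 ≠ 0 := hu1
  have hb1 : PowerSeries.coeff 1 (M.ι u).2 ≠ 0 := by rwa [M.lin_snd hn]
  have hab := M.mem u
  generalize hA : (M.ι u).1 = a at *
  generalize hB : (M.ι u).2 = b at *
  obtain ⟨a', ha'0, haa', ha'a⟩ := exists_subst_equiv a ha0 ha1
  obtain ⟨b', hb'0, hbb', hb'b⟩ := exists_subst_equiv b hb0 hb1
  have hsa := PowerSeries.HasSubst.of_constantCoeff_zero' ha0
  have hsb := PowerSeries.HasSubst.of_constantCoeff_zero' hb0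
  let Φ : A →ₐ[k] PowerSeries k × PowerSeries k :=
    ((PowerSeries.substAlgHom hsa).comp ((AlgHom.fst k _ _).comp M.ι)).prod
      ((PowerSeries.substAlgHom hsb).comp ((AlgHom.snd k _ _).comp M.ι))
  have hΦ : ∀ w, Φ w = ((M.ι w).1.subst a, (M.ι w).2.subst b) := by
    intro w
    simp only [Φ, AlgHom.prod_apply, AlgHom.comp_apply, PowerSeries.coe_substAlgHom]
    rfl
  have hmem : ∀ w, Φ w ∈ M.ι.range := by
    intro w
    rw [hΦ]
    obtain ⟨c, hc⟩ := M.lift h2 _ _ (subst_congr ha0 hb0 (M.mem w) hab)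
    exact ⟨c, hc⟩
  let e := AlgEquiv.ofInjective M.ι M.inj
  let ψ : A →ₐ[k] A := (e.symm : M.ι.range →ₐ[k] A).comp (Φ.codRestrict M.ι.range hmem)
  have hψ : ∀ w, M.ι (ψ w) = Φ w := by
    intro w
    have : e (ψ w) = ⟨Φ w, hmem w⟩ := e.apply_symm_apply _
    exact congrArg Subtype.val this
  have hinj : Function.Injective ψ := by
    intro w w' h
    apply M.inj
    have h1 := congrArg M.ι h
    rw [hψ, hψ, hΦ, hΦ] at h1
    have h3 := congrArg (fun p => PowerSeries.subst a' p.1) h1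
    have h4 := congrArg (fun p => PowerSeries.subst b' p.2) h1
    simp only [haa', hbb'] at h3 h4
    exact Prod.ext h3 h4
  have hsurj : Function.Surjective ψ := by
    intro w
    have hc : PowerSeries.X ^ n ∣ PowerSeries.subst a' (M.ι w).1 - PowerSeries.subst b' (M.ι w).2 := by
      have h1 : PowerSeries.X ^ n ∣
          PowerSeries.subst a (PowerSeries.subst a' (M.ι w).1) -
            PowerSeries.subst a (PowerSeries.subst b' (M.ι w).2) := by
        have h3 := subst_congr (n := n) (f := PowerSeries.subst b' (M.ι w).2) (g := PowerSeries.subst b' (M.ι w).2)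
          ha0 hb0 (by simp) hab
        rw [hb'b] at h3
        rw [ha'a]
        have := dvd_sub (M.mem w) h3
        convert this using 1
        ring
      have h4 := subst_congr (n := n) ha'0 ha'0 h1 (by simp)
      rwa [haa', haa'] at h4
    obtain ⟨c, hc⟩ := M.lift h2 _ _ hc
    refine ⟨c, M.inj ?_⟩
    rw [hψ, hΦ, hc, ha'a, hb'b]
  refine ⟨AlgEquiv.ofBijective ψ ⟨hinj, hsurj⟩, M.inj ?_⟩
  change M.ι (ψ M.x) = _
  rw [hψ, hΦ, M.ιx, PowerSeries.subst_X hsa, PowerSeries.subst_X hsb, ← hA, ← hB]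

lemma y_form (M : NodeModel k A n) (h2 : (2 : k) ≠ 0) (φ : A ≃ₐ[k] A) :
    M.ι (φ M.y) = ((M.ι (φ M.x)).1 ^ n, - (M.ι (φ M.x)).2 ^ n) ∨
    M.ι (φ M.y) = (-(M.ι (φ M.x)).1 ^ n, (M.ι (φ M.x)).2 ^ n) := by
  have hr : φ M.y ^ 2 = φ M.x ^ (2 * n) := by rw [← map_pow, M.rel, map_pow]
  have h1 := congrArg (fun a => (M.ι a).1) hr
  have h3 := congrArg (fun a => (M.ι a).2) hr
  simp only [map_pow, Prod.pow_fst, Prod.pow_snd, mul_comm 2 n, pow_mul] at h1 h3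
  rw [sq_eq_sq_iff_eq_or_eq_neg] at h1 h3
  have hX : (PowerSeries.X : PowerSeries k) ^ n ≠ 0 := pow_ne_zero _ PowerSeries.X_ne_zero
  have h2' := ps_two h2
  have n1 : φ M.y ≠ φ M.x ^ n := by
    rw [← map_pow]
    intro h
    have := congrArg (fun a => (M.ι a).2) (φ.injective h)
    simp only [map_pow, M.ιx, M.ιy, Prod.pow_snd] at this
    apply mul_ne_zero h2' hX
    linear_combination -this
  have n2 : φ M.y ≠ - φ M.x ^ n := by
    rw [← map_pow, ← map_neg]
    intro h
    have := congrArg (fun a => (M.ι a).1) (φ.injective h)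
    simp only [map_pow, map_neg, M.ιx, M.ιy, Prod.pow_fst, Prod.fst_neg] at this
    apply mul_ne_zero h2' hX
    linear_combination this
  rcases h1 with h1 | h1 <;> rcases h3 with h3 | h3
  · refine absurd (M.inj ?_) n1
    rw [map_pow]; exact Prod.ext h1 h3
  · left; exact Prod.ext h1 h3
  · right; exact Prod.ext h1 h3
  · refine absurd (M.inj ?_) n2
    rw [map_neg, map_pow]; exact Prod.ext h1 h3

lemma c0_x (M : NodeModel k A n) : M.c0 M.x = 0 := by rw [c0, M.ιx]; simp

lemma lin_x (M : NodeModel k A n) : M.lin M.x = 1 := by rw [lin, M.ιx]; simp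

lemma lin_alg_mul (M : NodeModel k A n) (c : k) (a : A) :
    M.lin (algebraMap k A c * a) = c * M.lin a := by
  rw [lin, map_mul, ι_alg]; exact PowerSeries.coeff_C_mul _ _ _

lemma c0_alg_mul (M : NodeModel k A n) (c : k) (a : A) :
    M.c0 (algebraMap k A c * a) = c * M.c0 a := by
  rw [c0, map_mul, ι_alg]; simp [c0]

lemma exist (M : NodeModel k A n) (h2 : (2 : k) ≠ 0) (hn : 2 ≤ n) (σ : A ≃ₐ[k] A)
    (hinv : ∀ a, σ (σ a) = a) : ∃ φ : A ≃ₐ[k] A,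
      (σ (φ M.x) = φ M.x ∨ σ (φ M.x) = - φ M.x) ∧ (σ (φ M.y) = φ M.y ∨ σ (φ M.y) = - φ M.y) := by
  have hc : M.lin (σ M.x) ^ 2 = 1 := by
    have : M.lin (σ (σ M.x)) = M.lin (σ M.x) * M.lin (σ M.x) :=
      M.lin_map h2 hn (σ : A →ₐ[k] A) (σ M.x) (M.c0_map h2 hn (σ : A →ₐ[k] A) _ M.c0_x)
    rw [hinv, M.lin_x] at this
    rw [this, sq]
  set c := M.lin (σ M.x) with hcd
  set u := M.x + algebraMap k A c * σ M.x with hud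
  have hσx : M.c0 (σ M.x) = 0 := M.c0_map h2 hn (σ : A →ₐ[k] A) _ M.c0_x
  have hu0 : M.c0 u = 0 := by
    have : M.c0 u = M.c0 M.x + M.c0 (algebraMap k A c * σ M.x) := by simp [hud, c0]
    rw [this, c0_alg_mul, hσx, c0_x]; simp
  have hu1 : M.lin u ≠ 0 := by
    have : M.lin u = M.lin M.x + M.lin (algebraMap k A c * σ M.x) := by simp [hud, lin]
    rw [this, lin_alg_mul, lin_x, ← hcd, ← sq, hc]
    intro h; apply h2; rw [← h]; norm_num
  obtain ⟨φ, hφ⟩ := M.exists_aut h2 hn u hu0 hu1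
  have hσu : σ u = u ∨ σ u = - u := by
    have e1 : σ u = σ M.x + algebraMap k A c * M.x := by
      rw [hud, map_add, map_mul, AlgEquiv.commutes, hinv]
    rcases (sq_eq_sq_iff_eq_or_eq_neg.1 (hc.trans (one_pow 2).symm)) with h | h
    · left; rw [e1, hud, h, map_one]; ring
    · right; rw [e1, hud, h, map_neg, map_one]; ring
  refine ⟨φ, by rwa [hφ], ?_⟩
  have f1 := M.y_form h2 φ
  have f2 := M.y_form h2 (φ.trans σ)
  simp only [AlgEquiv.trans_apply, hφ] at f1 f2
  have hp : (σ u) ^ n = u ^ n ∨ (σ u) ^ n = - u ^ n := by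
    rcases hσu with h | h
    · left; rw [h]
    · rw [h]
      rcases neg_one_pow_eq_or A n with h' | h'
      · left; rw [neg_pow, h', one_mul]
      · right; rw [neg_pow, h', neg_one_mul]
  have hp1 : ((M.ι (σ u)).1 ^ n = (M.ι u).1 ^ n ∧ (M.ι (σ u)).2 ^ n = (M.ι u).2 ^ n) ∨
      ((M.ι (σ u)).1 ^ n = -(M.ι u).1 ^ n ∧ (M.ι (σ u)).2 ^ n = -(M.ι u).2 ^ n) := by
    rcases hp with h | h
    · left
      have := congrArg M.ι h
      simp only [map_pow] at this
      exact ⟨congrArg Prod.fst this, congrArg Prod.snd this⟩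
    · right
      have := congrArg M.ι h
      simp only [map_pow, map_neg] at this
      exact ⟨congrArg Prod.fst this, congrArg Prod.snd this⟩
  have goal' : M.ι (σ (φ M.y)) = M.ι (φ M.y) ∨ M.ι (σ (φ M.y)) = - M.ι (φ M.y) := by
    rcases hp1 with ⟨q1, q2⟩ | ⟨q1, q2⟩ <;> rw [q1, q2] at f2 <;>
    rcases f1 with f1 | f1 <;> rcases f2 with f2 | f2 <;> rw [f1, f2] <;> simp
  rcases goal' with h | h
  · left; exact M.inj h
  · right; apply M.inj; rw [h, map_neg]

lemma lin_ne (M : NodeModel k A n) (h2 : (2 : k) ≠ 0) (hn : 2 ≤ n) (φ : A ≃ₐ[k] A) :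
    M.lin (φ M.x) ≠ 0 := by
  have h0 : M.c0 (φ M.x) = 0 := M.c0_map h2 hn (φ : A →ₐ[k] A) _ M.c0_x
  have : M.lin (φ.symm (φ M.x)) = M.lin (φ M.x) * M.lin (φ.symm M.x) :=
    M.lin_map h2 hn (φ.symm : A →ₐ[k] A) (φ M.x) h0
  rw [AlgEquiv.symm_apply_apply, M.lin_x] at this
  intro h
  rw [h, zero_mul] at this
  exact one_ne_zero this

lemma uniq_x (M : NodeModel k A n) (h2 : (2 : k) ≠ 0) (hn : 2 ≤ n) (σ φ : A ≃ₐ[k] A) (c : k)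
    (h : σ (φ M.x) = algebraMap k A c * φ M.x) : c = M.lin (σ M.x) := by
  have h0 : M.c0 (φ M.x) = 0 := M.c0_map h2 hn (φ : A →ₐ[k] A) _ M.c0_x
  have h3 : M.lin (σ (φ M.x)) = M.lin (φ M.x) * M.lin (σ M.x) :=
    M.lin_map h2 hn (σ : A →ₐ[k] A) (φ M.x) h0
  rw [h, lin_alg_mul, mul_comm] at h3
  exact mul_left_cancel₀ (M.lin_ne h2 hn φ) h3

lemma uniq_y (M : NodeModel k A n) (h2 : (2 : k) ≠ 0) (hn : 2 ≤ n) (σ φ φ' : A ≃ₐ[k] A)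
    (h : σ (φ M.x) = - φ M.x) (h' : σ (φ' M.x) = - φ' M.x)
    (hy : σ (φ M.y) = φ M.y) (hy' : σ (φ' M.y) = - φ' M.y) : False := by
  have f1 := M.y_form h2 φ
  have f2 := M.y_form h2 φ'
  have hvv : φ M.y * φ' M.y = (φ M.x * φ' M.x) ^ n ∨
      φ M.y * φ' M.y = - (φ M.x * φ' M.x) ^ n := by
    have : M.ι (φ M.y * φ' M.y) = M.ι ((φ M.x * φ' M.x) ^ n) ∨
      M.ι (φ M.y * φ' M.y) = M.ι (- (φ M.x * φ' M.x) ^ n) := by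
      rcases f1 with f1 | f1 <;> rcases f2 with f2 | f2
      · left; rw [map_mul, f1, f2, map_pow, map_mul]; ext1 <;> simp [mul_pow]
      · right; rw [map_mul, f1, f2, map_neg, map_pow, map_mul]; ext1 <;> simp [mul_pow]
      · right; rw [map_mul, f1, f2, map_neg, map_pow, map_mul]; ext1 <;> simp [mul_pow]
      · left; rw [map_mul, f1, f2, map_pow, map_mul]; ext1 <;> simp [mul_pow]
    exact this.imp (fun h => M.inj h) (fun h => M.inj h)
  have hfix : σ (φ M.y * φ' M.y) = φ M.y * φ' M.y := by
    rcases hvv with e | e <;> rw [e] <;> simp [h, h']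
  rw [map_mul, hy, hy'] at hfix
  have hne : ∀ ψ : A ≃ₐ[k] A, (M.ι (ψ M.y)).1 ≠ 0 := by
    intro ψ h0
    have hx0 : (M.ι (ψ M.x)).1 ^ n = 0 := by
      rcases M.y_form h2 ψ with f | f <;> rw [f] at h0
      · exact h0
      · exact neg_eq_zero.1 h0
    apply M.lin_ne h2 hn ψ
    rw [lin, eq_zero_of_pow_eq_zero hx0, map_zero]
  have h5 := congrArg (fun a => (M.ι a).1) hfix
  simp only [map_mul, map_neg, Prod.fst_mul, Prod.fst_neg] at h5
  apply mul_ne_zero (ps_two h2) (mul_ne_zero (hne φ) (hne φ'))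
  linear_combination -h5

end NodeModel

theorem stmt2 {k : Type*} [Field k] [IsAlgClosed k] (r : ℕ) (hr : Odd r) (hr3 : 3 ≤ r)
    (h2 : (2 : k) ≠ 0) (hr1 : ((r + 1 : ℕ) : k) ≠ 0)
    (σ : ArRing k r ≃ₐ[k] ArRing k r) (hinv : ∀ a, σ (σ a) = a)
    (hnt : σ ≠ (AlgEquiv.refl : ArRing k r ≃ₐ[k] ArRing k r)) :
    ∃! i : Fin 3, ∃ φ : ArRing k r ≃ₐ[k] ArRing k r,
      ((φ.trans σ).trans φ.symm) (ArRing.x k r)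
          = (if i = 0 then ArRing.x k r else - ArRing.x k r) ∧
      ((φ.trans σ).trans φ.symm) (ArRing.y k r)
          = (if i = 1 then ArRing.y k r else - ArRing.y k r) := by
  obtain ⟨m, hm⟩ := hr
  have hn : 2 ≤ m + 1 := by omega
  obtain ⟨M, hMx, hMy⟩ := nodeModel h2 r (m + 1) (by omega) (by omega)
  rw [← hMx, ← hMy]
  have hneg : (1 : k) ≠ -1 := by
    intro h; apply h2; linear_combination h
  have hconj : ∀ (φ : ArRing k r ≃ₐ[k] ArRing k r) (a b : ArRing k r),
      ((φ.trans σ).trans φ.symm) a = b ↔ σ (φ a) = φ b := by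
    intro φ a b
    rw [AlgEquiv.trans_apply, AlgEquiv.trans_apply, AlgEquiv.symm_apply_eq]
  simp only [hconj]
  apply existsUnique_of_exists_of_unique
  · obtain ⟨φ, hx, hy⟩ := M.exist h2 hn σ hinv
    rcases hx with hx | hx <;> rcases hy with hy | hy
    · exfalso
      apply hnt
      have := M.hext (((φ.trans σ).trans φ.symm : ArRing k r ≃ₐ[k] ArRing k r) :
        ArRing k r →ₐ[k] ArRing k r) ((hconj φ _ _).2 hx) ((hconj φ _ _).2 hy)
      ext a
      have h := (hconj φ (φ.symm a) (φ.symm a)).1 (this (φ.symm a))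
      rw [AlgEquiv.apply_symm_apply] at h
      exact h
    · exact ⟨0, φ, by simpa using hx, by simpa using hy⟩
    · exact ⟨1, φ, by simpa using hx, by simpa using hy⟩
    · exact ⟨2, φ, by simpa using hx, by simpa using hy⟩
  · rintro i j ⟨φ, hx, hy⟩ ⟨φ', hx', hy'⟩
    have key : ∀ (i : Fin 3) (φ : ArRing k r ≃ₐ[k] ArRing k r),
        σ (φ M.x) = φ (if i = 0 then M.x else - M.x) →
        (if i = 0 then (1 : k) else -1) = M.lin (σ M.x) := by
      intro i φ h
      apply M.uniq_x h2 hn σ φ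
      rw [h]
      split_ifs
      · rw [map_one, one_mul]
      · rw [map_neg, map_neg, map_one]; exact (neg_one_mul (φ M.x)).symm
    have e := (key i φ hx).trans (key j φ' hx').symm
    fin_cases i <;> fin_cases j <;> simp at e hx hy hx' hy' ⊢
    · exact hneg e
    · exact hneg e
    · exact hneg e.symm
    · exact M.uniq_y h2 hn σ φ φ' hx hx' hy hy'
    · exact hneg e.symm
    · exact M.uniq_y h2 hn σ φ' φ hx' hx hy' hy
end
end

section
/- Let k be an algebraically closed field of characteristic not 2 and A_1 = k[[x,y]]/(y²−x²). Then every non-trivial k-algebra involution of A_1 is conjugate by an automorphism of A_1 to one of: (x,y) ↦ (x,−y), (x,y) ↦ (−x,−y), or (x,y) ↦ (y,x). -/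
/-!
**Statement 3.** Let `k` be an algebraically closed field of characteristic not 2 and
`A_1 = k[[x,y]]/(y²−x²)`. Then every non-trivial `k`-algebra involution of `A_1` is conjugate
by an automorphism of `A_1` to one of: `(x,y) ↦ (x,−y)`, `(x,y) ↦ (−x,−y)`, or
`(x,y) ↦ (y,x)`.
-/

noncomputable section

open MvPowerSeries

/-- the node as a fibre product -/
def Nd (k : Type*) [Field k] : Subalgebra k (PowerSeries k × PowerSeries k) where
  carrier := {w | PowerSeries.constantCoeff w.1 = PowerSeries.constantCoeff w.2}
  mul_mem' {a b} ha hb := by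
    simp only [Set.mem_ofPred_eq] at *
    simp [ha, hb]
  add_mem' {a b} ha hb := by
    simp only [Set.mem_ofPred_eq] at *
    simp [ha, hb]
  algebraMap_mem' r := by
    simp

theorem mem_Nd {k : Type*} [Field k] (w : PowerSeries k × PowerSeries k) :
    w ∈ Nd k ↔ PowerSeries.constantCoeff w.1 = PowerSeries.constantCoeff w.2 := Iff.rfl

section partA
variable {k : Type*} [Field k]

theorem hasSubst_pair {τ : Type*} (a b : MvPowerSeries τ k) (ha : constantCoeff a = 0)
    (hb : constantCoeff b = 0) : HasSubst ![a, b] := by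
  apply hasSubst_of_constantCoeff_zero
  intro s
  fin_cases s
  · exact ha
  · exact hb

theorem decomp (f : PS2 k) : ∃ (F G : PowerSeries k) (h : PS2 k),
    f = F.subst (X 0 : PS2 k) + X 1 * G.subst (X 1 : PS2 k) + X 0 * X 1 * h := by
  have h1 : (X 1 : PS2 k) ∣ f - (PowerSeries.mk fun n => coeff (Finsupp.single 0 n) f).subst
      (X 0 : PS2 k) := by
    rw [X_dvd_iff]
    intro m hm
    have : m = Finsupp.single 0 (m 0) := by
      ext i; fin_cases i <;> simp [hm]
    rw [map_sub, PowerSeries.coeff_subst_single, if_pos this, PowerSeries.coeff_mk, ← this, sub_self]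
  obtain ⟨g, hg⟩ := h1
  have h2 : (X 0 : PS2 k) ∣ g - (PowerSeries.mk fun n => coeff (Finsupp.single 1 n) g).subst
      (X 1 : PS2 k) := by
    rw [X_dvd_iff]
    intro m hm
    have : m = Finsupp.single 1 (m 1) := by
      ext i; fin_cases i <;> simp [hm]
    rw [map_sub, PowerSeries.coeff_subst_single, if_pos this, PowerSeries.coeff_mk, ← this, sub_self]
  obtain ⟨h, hh⟩ := h2
  refine ⟨PowerSeries.mk fun n => coeff (Finsupp.single 0 n) f,
    PowerSeries.mk fun n => coeff (Finsupp.single 1 n) g, h, ?_⟩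
  rw [sub_eq_iff_eq_add] at hg hh
  generalize PowerSeries.subst (X 0 : PS2 k) (PowerSeries.mk fun n => coeff (Finsupp.single 0 n) f)
    = a at *
  generalize PowerSeries.subst (X 1 : PS2 k) (PowerSeries.mk fun n => coeff (Finsupp.single 1 n) g)
    = b at *
  rw [hg, hh]
  ring

theorem subst_pair_single {τ : Type*} (a b : MvPowerSeries τ k) (h : HasSubst ![a, b])
    (F : PowerSeries k) (i : Fin 2) :
    subst ![a, b] (F.subst (X i : PS2 k)) = F.subst (![a, b] i) := by
  rw [PowerSeries.subst_def, subst_comp_subst_apply (PowerSeries.HasSubst.X i).const h,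
    PowerSeries.subst_def]
  simp only [subst_X h]

theorem subst_pair_pair {τ : Type*} (c d : PS2 k) (a b : MvPowerSeries τ k) (h : HasSubst ![a, b])
    (h' : HasSubst ![c, d]) (f : PS2 k) :
    subst ![a, b] (subst ![c, d] f) = subst ![subst ![a,b] c, subst ![a,b] d] f := by
  rw [subst_comp_subst_apply h' h]
  congr 1
  ext1 s
  fin_cases s <;> rfl

theorem psi_surj (h2 : (2 : k) ≠ 0) (w : PS2 k) :
    ∃ f : PS2 k, subst ![(X 0 + X 1 : PS2 k), X 0 - X 1] f = w := by
  refine ⟨subst ![((2:k)⁻¹ • (X 0 + X 1) : PS2 k), (2:k)⁻¹ • (X 0 - X 1)] w, ?_⟩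
  have hs : HasSubst ![(X 0 + X 1 : PS2 k), X 0 - X 1] := hasSubst_pair _ _ (by simp) (by simp)
  have hs' : HasSubst ![((2:k)⁻¹ • (X 0 + X 1) : PS2 k), (2:k)⁻¹ • (X 0 - X 1)] :=
    hasSubst_pair _ _ (by simp) (by simp)
  rw [subst_pair_pair _ _ _ _ hs hs']
  have e1 : subst ![(X 0 + X 1 : PS2 k), X 0 - X 1] ((2:k)⁻¹ • (X 0 + X 1) : PS2 k) = X 0 := by
    rw [subst_smul hs, subst_add hs, subst_X hs, subst_X hs]
    simp only [Matrix.cons_val_zero, Matrix.cons_val_one]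
    rw [show (X 0 + X 1 + (X 0 - X 1) : PS2 k) = (2:k) • X 0 by rw [two_smul]; ring, smul_smul,
      inv_mul_cancel₀ h2, one_smul]
  have e2 : subst ![(X 0 + X 1 : PS2 k), X 0 - X 1] ((2:k)⁻¹ • (X 0 - X 1) : PS2 k) = X 1 := by
    rw [subst_smul hs, subst_sub hs, subst_X hs, subst_X hs]
    simp only [Matrix.cons_val_zero, Matrix.cons_val_one]
    rw [show (X 0 + X 1 - (X 0 - X 1) : PS2 k) = (2:k) • X 1 by rw [two_smul]; ring, smul_smul,
      inv_mul_cancel₀ h2, one_smul]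
  rw [e1, e2]
  have : ![(X 0 : PS2 k), X 1] = X := by
    ext1 s; fin_cases s <;> rfl
  rw [this, subst_self]; rfl

theorem exists_equiv (h2 : (2 : k) ≠ 0) : ∃ e : ArRing k 1 ≃ₐ[k] Nd k,
    (e (ArRing.x k 1) : PowerSeries k × PowerSeries k)
      = ((2:k)⁻¹ • PowerSeries.X, (2:k)⁻¹ • PowerSeries.X) ∧
    (e (ArRing.y k 1) : PowerSeries k × PowerSeries k)
      = ((2:k)⁻¹ • PowerSeries.X, - ((2:k)⁻¹ • PowerSeries.X)) := by
  let T : PowerSeries k := (2:k)⁻¹ • PowerSeries.X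
  have hT : PowerSeries.constantCoeff T = 0 := by simp [T]
  have hTT : T + T = PowerSeries.X := by
    simp only [T]
    rw [← two_smul k, smul_smul, mul_inv_cancel₀ h2, one_smul]
  have s1 : HasSubst (![T, T] : Fin 2 → MvPowerSeries Unit k) := hasSubst_pair _ _ hT hT
  have s2 : HasSubst (![T, -T] : Fin 2 → MvPowerSeries Unit k) :=
    hasSubst_pair _ _ hT (by
      change PowerSeries.constantCoeff (-T) = 0
      simp [hT])
  let p : PS2 k →ₐ[k] PowerSeries k × PowerSeries k :=
    AlgHom.prod (substAlgHom s1) (substAlgHom s2)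
  have p0 : p (X 0) = (T, T) := by
    exact Prod.ext (substAlgHom_X s1 0) (substAlgHom_X s2 0)
  have p1 : p (X 1) = (T, -T) := by
    exact Prod.ext (substAlgHom_X s1 1) (substAlgHom_X s2 1)
  have hs : HasSubst ![(X 0 + X 1 : PS2 k), X 0 - X 1] := hasSubst_pair _ _ (by simp) (by simp)
  have t1 : HasSubst (![PowerSeries.X, 0] : Fin 2 → MvPowerSeries Unit k) :=
    hasSubst_pair _ _ PowerSeries.constantCoeff_X (map_zero _)
  have t2 : HasSubst (![0, PowerSeries.X] : Fin 2 → MvPowerSeries Unit k) :=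
    hasSubst_pair _ _ (map_zero _) PowerSeries.constantCoeff_X
  have q1 : ∀ f : PS2 k, (p (subst ![(X 0 + X 1 : PS2 k), X 0 - X 1] f)).1
      = subst (![PowerSeries.X, 0] : Fin 2 → MvPowerSeries Unit k) f := by
    intro f
    change substAlgHom s1 _ = _
    rw [substAlgHom_apply, subst_pair_pair _ _ _ _ s1 hs, subst_add s1, subst_sub s1,
      subst_X s1, subst_X s1]
    simp only [Matrix.cons_val_zero, Matrix.cons_val_one]
    rw [sub_self]
    erw [hTT]
  have q2 : ∀ f : PS2 k, (p (subst ![(X 0 + X 1 : PS2 k), X 0 - X 1] f)).2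
      = subst (![0, PowerSeries.X] : Fin 2 → MvPowerSeries Unit k) f := by
    intro f
    change substAlgHom s2 _ = _
    rw [substAlgHom_apply, subst_pair_pair _ _ _ _ s2 hs, subst_add s2, subst_sub s2,
      subst_X s2, subst_X s2]
    simp only [Matrix.cons_val_zero, Matrix.cons_val_one]
    rw [sub_neg_eq_add, add_neg_cancel]
    erw [hTT]
  have z : ∀ F : PowerSeries k, F.subst (0 : MvPowerSeries Unit k)
      = PowerSeries.C (PowerSeries.constantCoeff F) := by
    intro F
    rw [PowerSeries.subst_zero_eq_C_constantCoeff]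
    exact MvPowerSeries.map_C _ _
  have v1 : ∀ (F G : PowerSeries k) (h : PS2 k), subst (![PowerSeries.X, 0] : Fin 2 → MvPowerSeries Unit k)
      (F.subst (X 0 : PS2 k) + X 1 * G.subst (X 1 : PS2 k) + X 0 * X 1 * h) = F := by
    intro F G h
    rw [subst_add t1, subst_add t1, subst_mul t1, subst_mul t1, subst_mul t1, subst_X t1,
      subst_X t1, subst_pair_single _ _ t1]
    simp only [Matrix.cons_val_zero, Matrix.cons_val_one]
    rw [zero_mul, mul_zero, zero_mul, add_zero, add_zero]
    exact PowerSeries.X_subst F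
  have v2 : ∀ (F G : PowerSeries k) (h : PS2 k), subst (![0, PowerSeries.X] : Fin 2 → MvPowerSeries Unit k)
      (F.subst (X 0 : PS2 k) + X 1 * G.subst (X 1 : PS2 k) + X 0 * X 1 * h)
        = PowerSeries.C (PowerSeries.constantCoeff F) + PowerSeries.X * G := by
    intro F G h
    rw [subst_add t2, subst_add t2, subst_mul t2, subst_mul t2, subst_mul t2, subst_X t2,
      subst_X t2, subst_pair_single _ _ t2, subst_pair_single _ _ t2]
    simp only [Matrix.cons_val_zero, Matrix.cons_val_one]
    rw [zero_mul, zero_mul, add_zero, z]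
    congr 2
    exact PowerSeries.X_subst G
  have hmem : ∀ w, p w ∈ Nd k := by
    intro w
    obtain ⟨f, rfl⟩ := psi_surj h2 w
    obtain ⟨F, G, h, rfl⟩ := decomp f
    rw [mem_Nd, q1, q2, v1, v2]
    simp
  let p' : PS2 k →ₐ[k] Nd k := p.codRestrict _ hmem
  have hker : ∀ w, p w = 0 → w ∈ Ideal.span {(X (1 : Fin 2) : PS2 k) ^ 2 - (X (0 : Fin 2) : PS2 k) ^ (1 + 1)} := by
    intro w hw
    obtain ⟨f, rfl⟩ := psi_surj h2 w
    obtain ⟨F, G, h, rfl⟩ := decomp f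
    have hF : F = 0 := by rw [← v1 F G h, ← q1, hw]; rfl
    have hG : G = 0 := by
      have := v2 F G h
      rw [← q2, hw, hF] at this
      simpa using this.symm
    subst hF hG
    have zz : ∀ i, (0 : PowerSeries k).subst (X i : PS2 k) = 0 := by
      intro i
      rw [← PowerSeries.coe_substAlgHom (PowerSeries.HasSubst.X i), map_zero]
    rw [zz, zz, mul_zero, add_zero, zero_add, subst_mul hs, subst_mul hs, subst_X hs, subst_X hs]
    simp only [Matrix.cons_val_zero, Matrix.cons_val_one]
    rw [Ideal.mem_span_singleton]
    exact ⟨- subst ![(X 0 + X 1 : PS2 k), X 0 - X 1] h, by ring⟩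
  let P : ArRing k 1 →ₐ[k] Nd k := Ideal.Quotient.liftₐ _ p' (by
    intro a ha
    rw [Ideal.mem_span_singleton] at ha
    obtain ⟨c, rfl⟩ := ha
    apply Subtype.ext
    change p _ = 0
    rw [map_mul, map_sub, map_pow, map_pow, p0, p1]
    ext1 <;> simp)
  have hP : ∀ w, P (Ideal.Quotient.mk _ w) = p' w := fun w => rfl
  have hbij : Function.Bijective P := by
    constructor
    · rw [injective_iff_map_eq_zero]
      intro a ha
      obtain ⟨w, rfl⟩ := Ideal.Quotient.mk_surjective a
      rw [hP] at ha
      rw [Ideal.Quotient.eq_zero_iff_mem]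
      apply hker
      exact congrArg Subtype.val ha
    · rintro ⟨⟨F, G⟩, hFG⟩
      rw [mem_Nd] at hFG
      simp only at hFG
      have : PowerSeries.X ∣ G - PowerSeries.C (PowerSeries.constantCoeff F) := by
        rw [PowerSeries.X_dvd_iff]; simp [hFG]
      obtain ⟨G', hG'⟩ := this
      refine ⟨Ideal.Quotient.mk _ (subst ![(X 0 + X 1 : PS2 k), X 0 - X 1]
        (F.subst (X 0 : PS2 k) + X 1 * G'.subst (X 1 : PS2 k) + X 0 * X 1 * 0)), ?_⟩
      rw [hP]
      apply Subtype.ext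
      change p _ = (F, G)
      ext1
      · rw [q1, v1]
      · rw [q2, v2, ← hG']; ring
  refine ⟨AlgEquiv.ofBijective P hbij, ?_, ?_⟩
  · exact p0
  · exact p1
end partA

section partB
variable {k : Type*} [Field k]

/-- first branch element -/
def Nd.ofL (f : PowerSeries k) (h : PowerSeries.constantCoeff f = 0) : Nd k :=
  ⟨(f, 0), by rw [mem_Nd]; simp [h]⟩
/-- second branch element -/
def Nd.ofR (f : PowerSeries k) (h : PowerSeries.constantCoeff f = 0) : Nd k :=
  ⟨(0, f), by rw [mem_Nd]; simp [h]⟩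
/-- coordinate on the first branch -/
def Nd.U (k : Type*) [Field k] : Nd k := Nd.ofL PowerSeries.X (by simp)
/-- coordinate on the second branch -/
def Nd.V (k : Type*) [Field k] : Nd k := Nd.ofR PowerSeries.X (by simp)

theorem Nd.ext' {a b : Nd k} (h1 : a.1.1 = b.1.1) (h2 : a.1.2 = b.1.2) : a = b :=
  Subtype.ext (Prod.ext h1 h2)

theorem Nd.mul_fst (a b : Nd k) : (a * b).1.1 = a.1.1 * b.1.1 := rfl
theorem Nd.mul_snd (a b : Nd k) : (a * b).1.2 = a.1.2 * b.1.2 := rfl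

theorem Nd.UV : Nd.U k * Nd.V k = 0 := by
  apply Nd.ext'
  · change PowerSeries.X * (0 : PowerSeries k) = 0
    simp
  · change (0 : PowerSeries k) * PowerSeries.X = 0
    simp

theorem coeff_one_X_mul' (f : PowerSeries k) :
    PowerSeries.coeff 1 (PowerSeries.X * f) = PowerSeries.constantCoeff f := by
  have := PowerSeries.coeff_succ_X_mul 0 f
  simpa using this

theorem Nd.ofL_eq (f : PowerSeries k) (h : PowerSeries.constantCoeff f = 0) :
    ∃ r : Nd k, Nd.ofL f h = Nd.U k * r ∧ PowerSeries.constantCoeff r.1.1 = PowerSeries.coeff 1 f := by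
  obtain ⟨f', rfl⟩ := PowerSeries.X_dvd_iff.2 h
  refine ⟨⟨(f', PowerSeries.C (PowerSeries.constantCoeff f')), by rw [mem_Nd]; simp⟩, ?_, ?_⟩
  · apply Nd.ext'
    · rfl
    · change (0 : PowerSeries k) = 0 * _
      simp
  · change PowerSeries.constantCoeff f' = _
    rw [coeff_one_X_mul']

theorem Nd.ofR_eq (f : PowerSeries k) (h : PowerSeries.constantCoeff f = 0) :
    ∃ r : Nd k, Nd.ofR f h = Nd.V k * r := by
  obtain ⟨f', rfl⟩ := PowerSeries.X_dvd_iff.2 h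
  refine ⟨⟨(PowerSeries.C (PowerSeries.constantCoeff f'), f'), by rw [mem_Nd]; simp⟩, ?_⟩
  apply Nd.ext'
  · change (0 : PowerSeries k) = 0 * _
    simp
  · rfl

theorem Nd.decomp (w : Nd k) : ∃ r s : Nd k,
    w = algebraMap k (Nd k) (PowerSeries.constantCoeff w.1.1) + Nd.U k * r + Nd.V k * s := by
  have h1 : PowerSeries.constantCoeff (w.1.1 - PowerSeries.C (PowerSeries.constantCoeff w.1.1)) = 0 := by
    simp
  have h2 : PowerSeries.constantCoeff (w.1.2 - PowerSeries.C (PowerSeries.constantCoeff w.1.1)) = 0 := by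
    have := w.2
    rw [mem_Nd] at this
    simp [this]
  obtain ⟨r, hr, -⟩ := Nd.ofL_eq _ h1
  obtain ⟨s, hs⟩ := Nd.ofR_eq _ h2
  refine ⟨r, s, ?_⟩
  rw [← hr, ← hs]
  apply Nd.ext'
  · change _ = PowerSeries.C _ + (w.1.1 - PowerSeries.C _) + 0
    ring
  · change _ = PowerSeries.C _ + 0 + (w.1.2 - PowerSeries.C _)
    ring

theorem Nd.cc_map (τ : Nd k →ₐ[k] Nd k) (hU : PowerSeries.constantCoeff (τ (Nd.U k)).1.1 = 0)
    (hV : PowerSeries.constantCoeff (τ (Nd.V k)).1.1 = 0) (w : Nd k) :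
    PowerSeries.constantCoeff (τ w).1.1 = PowerSeries.constantCoeff w.1.1 := by
  obtain ⟨r, s, h⟩ := Nd.decomp w
  have : τ w = algebraMap k (Nd k) (PowerSeries.constantCoeff w.1.1) + τ (Nd.U k) * τ r
      + τ (Nd.V k) * τ s := by
    conv_lhs => rw [h]
    simp
  rw [this]
  change PowerSeries.constantCoeff (PowerSeries.C _ + (τ (Nd.U k)).1.1 * (τ r).1.1
    + (τ (Nd.V k)).1.1 * (τ s).1.1) = _
  simp [hU, hV]

theorem coeff_one_mul' (a h : PowerSeries k) (ha : PowerSeries.constantCoeff a = 0) :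
    PowerSeries.coeff 1 (a * h) = PowerSeries.coeff 1 a * PowerSeries.constantCoeff h := by
  obtain ⟨b, rfl⟩ := PowerSeries.X_dvd_iff.2 ha
  rw [mul_assoc, coeff_one_X_mul', coeff_one_X_mul', map_mul]

theorem Nd.coeff_map (τ : Nd k →ₐ[k] Nd k) (hU : PowerSeries.constantCoeff (τ (Nd.U k)).1.1 = 0)
    (hV : PowerSeries.constantCoeff (τ (Nd.V k)).1.1 = 0) (f : PowerSeries k)
    (h : PowerSeries.constantCoeff f = 0) :
    PowerSeries.coeff 1 (τ (Nd.ofL f h)).1.1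
      = PowerSeries.coeff 1 (τ (Nd.U k)).1.1 * PowerSeries.coeff 1 f := by
  obtain ⟨r, hr, hr'⟩ := Nd.ofL_eq f h
  rw [hr, map_mul, Nd.mul_fst, coeff_one_mul' _ _ hU, Nd.cc_map τ hU hV, hr']

theorem Nd.rigid (τ : Nd k →ₐ[k] Nd k) (hU : τ (Nd.U k) = Nd.U k) (hV : τ (Nd.V k) = Nd.V k)
    (w : Nd k) : τ w = w := by
  have key : ∀ (n : ℕ) (w : Nd k), ∃ w0 r s : Nd k, τ w0 = w0 ∧
      w = w0 + Nd.U k ^ (n + 1) * r + Nd.V k ^ (n + 1) * s := by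
    intro n
    induction n with
    | zero =>
      intro w
      obtain ⟨r, s, h⟩ := Nd.decomp w
      exact ⟨_, r, s, AlgHom.commutes _ _, by simpa using h⟩
    | succ n ih =>
      intro w
      obtain ⟨w0, r, s, h0, h⟩ := ih w
      obtain ⟨r1, r2, hr⟩ := Nd.decomp r
      obtain ⟨s1, s2, hs⟩ := Nd.decomp s
      generalize PowerSeries.constantCoeff r.1.1 = c at hr
      generalize PowerSeries.constantCoeff s.1.1 = d at hs
      refine ⟨w0 + Nd.U k ^ (n + 1) * algebraMap k _ c + Nd.V k ^ (n + 1) * algebraMap k _ d,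
        r1, s2, ?_, ?_⟩
      · simp [h0, hU, hV]
      · rw [h, hr, hs]
        have := Nd.UV (k := k)
        linear_combination (Nd.U k ^ n * r2 + Nd.V k ^ n * s1) * this
  have pw : ∀ (n : ℕ) (W : Nd k), (W ^ n).1 = W.1 ^ n := fun n W => rfl
  have zero_of : ∀ f : PowerSeries k, (∀ n : ℕ, PowerSeries.X ^ (n + 1) ∣ f) → f = 0 := by
    intro f hf
    ext n
    rw [PowerSeries.X_pow_dvd_iff.1 (hf n) n (Nat.lt_succ_self n), map_zero]
  rw [← sub_eq_zero]
  have dd : ∀ n : ℕ, ∃ r s : Nd k, τ w - w = Nd.U k ^ (n + 1) * r + Nd.V k ^ (n + 1) * s := by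
    intro n
    obtain ⟨w0, r, s, h0, h⟩ := key n w
    refine ⟨τ r - r, τ s - s, ?_⟩
    rw [h]
    simp only [map_add, map_mul, map_pow, h0, hU, hV]
    ring
  apply Nd.ext'
  · apply zero_of
    intro n
    obtain ⟨r, s, h⟩ := dd n
    rw [h]
    change _ ∣ PowerSeries.X ^ (n + 1) * r.1.1 + 0 ^ (n + 1) * s.1.1
    simp
  · apply zero_of
    intro n
    obtain ⟨r, s, h⟩ := dd n
    rw [h]
    change _ ∣ 0 ^ (n + 1) * r.1.2 + PowerSeries.X ^ (n + 1) * s.1.2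
    simp

/-- exchange of the branches -/
def Nd.swapHom (k : Type*) [Field k] : Nd k →ₐ[k] Nd k :=
  ((AlgHom.prod (AlgHom.snd k _ _) (AlgHom.fst k _ _)).comp (Nd k).val).codRestrict _ (by
    intro w
    have := w.2
    rw [mem_Nd] at this ⊢
    exact this.symm)

/-- exchange of the branches -/
def Nd.swap (k : Type*) [Field k] : Nd k ≃ₐ[k] Nd k :=
  AlgEquiv.ofAlgHom (Nd.swapHom k) (Nd.swapHom k) (by ext1; rfl) (by ext1; rfl)

theorem Nd.swap_L (f : PowerSeries k) (h : PowerSeries.constantCoeff f = 0) :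
    Nd.swap k (Nd.ofL f h) = Nd.ofR f h := rfl
theorem Nd.swap_R (f : PowerSeries k) (h : PowerSeries.constantCoeff f = 0) :
    Nd.swap k (Nd.ofR f h) = Nd.ofL f h := rfl
theorem Nd.swap_U : Nd.swap k (Nd.U k) = Nd.V k := rfl
theorem Nd.swap_V : Nd.swap k (Nd.V k) = Nd.U k := rfl
theorem Nd.swap_swap (w : Nd k) : Nd.swap k (Nd.swap k w) = w := rfl

/-- substitution on both branches -/
def Nd.substHom (p q : PowerSeries k) (hp : PowerSeries.constantCoeff p = 0)
    (hq : PowerSeries.constantCoeff q = 0) : Nd k →ₐ[k] Nd k :=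
  ((AlgHom.prodMap (PowerSeries.substAlgHom (R := k) (PowerSeries.HasSubst.of_constantCoeff_zero' hp))
    (PowerSeries.substAlgHom (R := k) (PowerSeries.HasSubst.of_constantCoeff_zero' hq))).comp
      (Nd k).val).codRestrict _ (by
    intro w
    obtain ⟨⟨f, g⟩, hw⟩ := w
    rw [mem_Nd] at hw ⊢
    simp only at hw
    have key : ∀ (p f : PowerSeries k), PowerSeries.constantCoeff p = 0 →
        PowerSeries.constantCoeff (f.subst p) = PowerSeries.constantCoeff f := by
      intro p f hp
      have hs := PowerSeries.HasSubst.of_constantCoeff_zero' hp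
      obtain ⟨f', hf'⟩ : PowerSeries.X ∣ f - PowerSeries.C (PowerSeries.constantCoeff f) := by
        rw [PowerSeries.X_dvd_iff]; simp
      rw [sub_eq_iff_eq_add] at hf'
      conv_lhs => rw [hf']
      rw [PowerSeries.subst_add hs, PowerSeries.subst_mul hs, PowerSeries.subst_X hs,
        PowerSeries.subst_C]
      change PowerSeries.constantCoeff (p * _ + PowerSeries.C _) = _
      rw [map_add, map_mul, hp]
      simp
    change PowerSeries.constantCoeff (PowerSeries.substAlgHom (PowerSeries.HasSubst.of_constantCoeff_zero' hp) f) =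
      PowerSeries.constantCoeff (PowerSeries.substAlgHom (PowerSeries.HasSubst.of_constantCoeff_zero' hq) g)
    rw [PowerSeries.coe_substAlgHom, PowerSeries.coe_substAlgHom, key p f hp, key q g hq, hw])

theorem Nd.substHom_fst (p q : PowerSeries k) (hp : PowerSeries.constantCoeff p = 0)
    (hq : PowerSeries.constantCoeff q = 0) (w : Nd k) :
    (Nd.substHom p q hp hq w).1.1 = w.1.1.subst p := by
  change PowerSeries.substAlgHom (PowerSeries.HasSubst.of_constantCoeff_zero' hp) w.1.1 = _
  rw [PowerSeries.coe_substAlgHom]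

theorem Nd.substHom_snd (p q : PowerSeries k) (hp : PowerSeries.constantCoeff p = 0)
    (hq : PowerSeries.constantCoeff q = 0) (w : Nd k) :
    (Nd.substHom p q hp hq w).1.2 = w.1.2.subst q := by
  change PowerSeries.substAlgHom (PowerSeries.HasSubst.of_constantCoeff_zero' hq) w.1.2 = _
  rw [PowerSeries.coe_substAlgHom]

theorem Nd.exists_aut (p q : PowerSeries k) (hp : PowerSeries.constantCoeff p = 0)
    (hq : PowerSeries.constantCoeff q = 0) (hp1 : PowerSeries.coeff 1 p ≠ 0)
    (hq1 : PowerSeries.coeff 1 q ≠ 0) :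
    ∃ φ : Nd k ≃ₐ[k] Nd k, φ (Nd.U k) = Nd.ofL p hp ∧ φ (Nd.V k) = Nd.ofR q hq := by
  have sp := PowerSeries.HasSubst.of_constantCoeff_zero' hp
  have sq := PowerSeries.HasSubst.of_constantCoeff_zero' hq
  let p' := p.substInvOfIsUnit hp1.isUnit
  let q' := q.substInvOfIsUnit hq1.isUnit
  have hp' : PowerSeries.constantCoeff p' = 0 := PowerSeries.constantCoeff_substInvOfIsUnit _ _
  have hq' : PowerSeries.constantCoeff q' = 0 := PowerSeries.constantCoeff_substInvOfIsUnit _ _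
  have sp' := PowerSeries.HasSubst.of_constantCoeff_zero' hp'
  have sq' := PowerSeries.HasSubst.of_constantCoeff_zero' hq'
  have zz : ∀ p : PowerSeries k, PowerSeries.HasSubst p → (0 : PowerSeries k).subst p = 0 := by
    intro p hp
    rw [← PowerSeries.coe_substAlgHom hp, map_zero]
  refine ⟨AlgEquiv.ofAlgHom (Nd.substHom p q hp hq) (Nd.substHom p' q' hp' hq') ?_ ?_, ?_, ?_⟩
  · ext1 w
    apply Nd.ext'
    · change (Nd.substHom p q hp hq (Nd.substHom p' q' hp' hq' w)).1.1 = w.1.1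
      rw [Nd.substHom_fst, Nd.substHom_fst, PowerSeries.subst_comp_subst_apply sp' sp,
        PowerSeries.subst_substInvOfIsUnit_left p hp, PowerSeries.X_subst]
    · change (Nd.substHom p q hp hq (Nd.substHom p' q' hp' hq' w)).1.2 = w.1.2
      rw [Nd.substHom_snd, Nd.substHom_snd, PowerSeries.subst_comp_subst_apply sq' sq,
        PowerSeries.subst_substInvOfIsUnit_left q hq, PowerSeries.X_subst]
  · ext1 w
    apply Nd.ext'
    · change (Nd.substHom p' q' hp' hq' (Nd.substHom p q hp hq w)).1.1 = w.1.1
      rw [Nd.substHom_fst, Nd.substHom_fst, PowerSeries.subst_comp_subst_apply sp sp',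
        PowerSeries.subst_substInvOfIsUnit_right p hp, PowerSeries.X_subst]
    · change (Nd.substHom p' q' hp' hq' (Nd.substHom p q hp hq w)).1.2 = w.1.2
      rw [Nd.substHom_snd, Nd.substHom_snd, PowerSeries.subst_comp_subst_apply sq sq',
        PowerSeries.subst_substInvOfIsUnit_right q hq, PowerSeries.X_subst]
  · apply Nd.ext'
    · exact (Nd.substHom_fst p q hp hq _).trans (PowerSeries.subst_X sp)
    · exact (Nd.substHom_snd p q hp hq _).trans (zz _ sq)
  · apply Nd.ext'
    · exact (Nd.substHom_fst p q hp hq _).trans (zz _ sp)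
    · exact (Nd.substHom_snd p q hp hq _).trans (PowerSeries.subst_X sq)

theorem Nd.eigen (h2 : (2 : k) ≠ 0) (σ : Nd k ≃ₐ[k] Nd k) (hinv : ∀ a, σ (σ a) = a)
    (hU2 : (σ (Nd.U k)).1.2 = 0) (hV : (σ (Nd.V k)).1.1 = 0) :
    ∃ (p : PowerSeries k) (hp : PowerSeries.constantCoeff p = 0), PowerSeries.coeff 1 p ≠ 0 ∧
      (σ (Nd.ofL p hp) = Nd.ofL p hp ∨ σ (Nd.ofL p hp) = - Nd.ofL p hp) := by
  set a := (σ (Nd.U k)).1.1 with ha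
  have ha0 : PowerSeries.constantCoeff a = 0 := by
    have := (σ (Nd.U k)).2
    rw [mem_Nd, hU2] at this
    simpa using this
  have hσU : σ (Nd.U k) = Nd.ofL a ha0 := Nd.ext' rfl hU2
  have h1 := Nd.coeff_map (σ : Nd k →ₐ[k] Nd k) ha0 (by
    change PowerSeries.constantCoeff (σ (Nd.V k)).1.1 = 0
    simp [hV]) a ha0
  have e1 : (σ : Nd k →ₐ[k] Nd k) (Nd.ofL a ha0) = Nd.U k := by
    rw [← hσU]; exact hinv _
  have e2 : ((σ : Nd k →ₐ[k] Nd k) (Nd.U k)).1.1 = a := rfl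
  have e3 : (Nd.U k).1.1 = PowerSeries.X := rfl
  rw [e1, e2, e3, PowerSeries.coeff_one_X] at h1
  rcases mul_self_eq_one_iff.1 h1.symm with h | h
  · have hp : PowerSeries.constantCoeff (PowerSeries.X + a) = 0 := by simp [ha0]
    refine ⟨PowerSeries.X + a, hp, ?_, Or.inl ?_⟩
    · rw [map_add, h, PowerSeries.coeff_one_X, one_add_one_eq_two]; exact h2
    · have : Nd.ofL _ hp = Nd.U k + σ (Nd.U k) := by
        rw [hσU]
        apply Nd.ext'
        · rfl
        · change (0 : PowerSeries k) = 0 + 0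
          simp
      rw [this, map_add, hinv, add_comm]
  · have hp : PowerSeries.constantCoeff (PowerSeries.X - a) = 0 := by simp [ha0]
    refine ⟨PowerSeries.X - a, hp, ?_, Or.inr ?_⟩
    · rw [map_sub, h, PowerSeries.coeff_one_X, sub_neg_eq_add, one_add_one_eq_two]; exact h2
    · have : Nd.ofL _ hp = Nd.U k - σ (Nd.U k) := by
        rw [hσU]
        apply Nd.ext'
        · rfl
        · change (0 : PowerSeries k) = 0 - 0
          simp
      rw [this, map_sub, hinv, neg_sub]

theorem Nd.main (h2 : (2 : k) ≠ 0) (σ : Nd k ≃ₐ[k] Nd k) (hinv : ∀ a, σ (σ a) = a)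
    (hnt : ∃ a, σ a ≠ a) : ∃ φ : Nd k ≃ₐ[k] Nd k,
      (σ (φ (Nd.U k)) = φ (Nd.V k) ∧ σ (φ (Nd.V k)) = φ (Nd.U k)) ∨
      (σ (φ (Nd.U k)) = - φ (Nd.U k) ∧ σ (φ (Nd.V k)) = - φ (Nd.V k)) ∨
      (σ (φ (Nd.U k)) = φ (Nd.U k) ∧ σ (φ (Nd.V k)) = - φ (Nd.V k)) := by
  have hUV : σ (Nd.U k) * σ (Nd.V k) = 0 := by rw [← map_mul, Nd.UV, map_zero]
  have hm1 : (σ (Nd.U k)).1.1 * (σ (Nd.V k)).1.1 = 0 := by rw [← Nd.mul_fst, hUV]; rfl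
  have hm2 : (σ (Nd.U k)).1.2 * (σ (Nd.V k)).1.2 = 0 := by rw [← Nd.mul_snd, hUV]; rfl
  have hU0 : ¬ ((σ (Nd.U k)).1.1 = 0 ∧ (σ (Nd.U k)).1.2 = 0) := by
    rintro ⟨h, h'⟩
    have h0 : σ (Nd.U k) = 0 := Nd.ext' h h'
    rw [map_eq_zero_iff σ σ.injective] at h0
    exact PowerSeries.X_ne_zero (congrArg (fun w : Nd k => w.1.1) h0)
  have hV0 : ¬ ((σ (Nd.V k)).1.1 = 0 ∧ (σ (Nd.V k)).1.2 = 0) := by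
    rintro ⟨h, h'⟩
    have h0 : σ (Nd.V k) = 0 := Nd.ext' h h'
    rw [map_eq_zero_iff σ σ.injective] at h0
    exact PowerSeries.X_ne_zero (congrArg (fun w : Nd k => w.1.2) h0)
  rw [mul_eq_zero] at hm1 hm2
  by_cases hc : (σ (Nd.U k)).1.1 = 0
  · -- exchange case
    have hV2 : (σ (Nd.V k)).1.2 = 0 := by tauto
    set b := (σ (Nd.U k)).1.2 with hb
    have hb0 : PowerSeries.constantCoeff b = 0 := by
      have := (σ (Nd.U k)).2
      rw [mem_Nd, hc] at this
      simpa using this.symm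
    have hc0 : PowerSeries.constantCoeff (σ (Nd.V k)).1.1 = 0 := by
      have := (σ (Nd.V k)).2
      rw [mem_Nd, hV2] at this
      simpa using this
    have hσU : σ (Nd.U k) = Nd.ofR b hb0 := Nd.ext' hc rfl
    have h1 := Nd.coeff_map ((σ : Nd k →ₐ[k] Nd k).comp (Nd.swapHom k)) hc0 (by
      change PowerSeries.constantCoeff (σ (Nd.U k)).1.1 = 0
      simp [hc]) b hb0
    have e1 : ((σ : Nd k →ₐ[k] Nd k).comp (Nd.swapHom k)) (Nd.ofL b hb0) = Nd.U k := by
      change σ (Nd.ofR b hb0) = _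
      rw [← hσU]; exact hinv _
    have e3 : (Nd.U k).1.1 = PowerSeries.X := rfl
    rw [e1, e3, PowerSeries.coeff_one_X] at h1
    have hb1 : PowerSeries.coeff 1 b ≠ 0 := by
      intro h
      rw [h, mul_zero] at h1
      exact one_ne_zero h1
    obtain ⟨φ, f1, f2⟩ := Nd.exists_aut PowerSeries.X b (by simp) hb0 (by simp) hb1
    refine ⟨φ, Or.inl ?_⟩
    have f1' : φ (Nd.U k) = Nd.U k := f1
    rw [f1', f2, ← hσU, hinv]
    exact ⟨rfl, rfl⟩
  · have hV1 : (σ (Nd.V k)).1.1 = 0 := by tauto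
    have hU2 : (σ (Nd.U k)).1.2 = 0 := by tauto
    obtain ⟨p, hp, hp1, hep⟩ := Nd.eigen h2 σ hinv hU2 hV1
    obtain ⟨q, hq, hq1, heq⟩ := Nd.eigen h2 (((Nd.swap k).trans σ).trans (Nd.swap k)) (by
      intro a
      simp only [AlgEquiv.trans_apply, Nd.swap_swap, hinv]) (by
      simp only [AlgEquiv.trans_apply]; exact hV1) (by
      simp only [AlgEquiv.trans_apply]; exact hU2)
    simp only [AlgEquiv.trans_apply, Nd.swap_L] at heq
    have heq' : σ (Nd.ofR q hq) = Nd.ofR q hq ∨ σ (Nd.ofR q hq) = - Nd.ofR q hq := by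
      rcases heq with h | h
      · left
        have := congrArg (Nd.swap k) h
        rwa [Nd.swap_swap, Nd.swap_L] at this
      · right
        have := congrArg (Nd.swap k) h
        rwa [Nd.swap_swap, map_neg, Nd.swap_L] at this
    obtain ⟨φ, f1, f2⟩ := Nd.exists_aut p q hp hq hp1 hq1
    rw [← f1] at hep
    rw [← f2] at heq'
    rcases hep with h | h <;> rcases heq' with h' | h'
    · exfalso
      obtain ⟨a, ha⟩ := hnt
      apply ha
      have := Nd.rigid (((φ.trans σ).trans φ.symm : Nd k ≃ₐ[k] Nd k) : Nd k →ₐ[k] Nd k)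
        (by simp [h]) (by simp [h']) (φ.symm a)
      simpa using this
    · exact ⟨φ, Or.inr (Or.inr ⟨h, h'⟩)⟩
    · exact ⟨(Nd.swap k).trans φ, Or.inr (Or.inr (by
        simp only [AlgEquiv.trans_apply, Nd.swap_U, Nd.swap_V]; exact ⟨h', h⟩))⟩
    · exact ⟨φ, Or.inr (Or.inl ⟨h, h'⟩)⟩
end partB

theorem stmt3 {k : Type*} [Field k] [IsAlgClosed k] (h2 : (2 : k) ≠ 0)
    (σ : ArRing k 1 ≃ₐ[k] ArRing k 1) (hinv : ∀ a, σ (σ a) = a)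
    (hnt : σ ≠ (AlgEquiv.refl : ArRing k 1 ≃ₐ[k] ArRing k 1)) :
    ∃ φ : ArRing k 1 ≃ₐ[k] ArRing k 1,
      (((φ.trans σ).trans φ.symm) (ArRing.x k 1) = ArRing.x k 1 ∧
        ((φ.trans σ).trans φ.symm) (ArRing.y k 1) = - ArRing.y k 1) ∨
      (((φ.trans σ).trans φ.symm) (ArRing.x k 1) = - ArRing.x k 1 ∧
        ((φ.trans σ).trans φ.symm) (ArRing.y k 1) = - ArRing.y k 1) ∨
      (((φ.trans σ).trans φ.symm) (ArRing.x k 1) = ArRing.y k 1 ∧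
        ((φ.trans σ).trans φ.symm) (ArRing.y k 1) = ArRing.x k 1) := by
  obtain ⟨e, hx, hy⟩ := exists_equiv h2
  have ex : e (ArRing.x k 1) = (2:k)⁻¹ • (Nd.U k + Nd.V k) := by
    apply Subtype.ext
    rw [hx]
    change _ = (2:k)⁻¹ • ((PowerSeries.X, 0) + (0, PowerSeries.X) : PowerSeries k × PowerSeries k)
    simp
  have ey : e (ArRing.y k 1) = (2:k)⁻¹ • (Nd.U k - Nd.V k) := by
    apply Subtype.ext
    rw [hy]
    change _ = (2:k)⁻¹ • ((PowerSeries.X, 0) - (0, PowerSeries.X) : PowerSeries k × PowerSeries k)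
    simp
  obtain ⟨φ, hφ⟩ := Nd.main h2 ((e.symm.trans σ).trans e) (by intro a; simp [hinv]) (by
    by_contra hcon
    push Not at hcon
    apply hnt
    ext1 a
    have := hcon (e a)
    simpa using this)
  refine ⟨(e.trans φ).trans e.symm, ?_⟩
  have red : ∀ a b : ArRing k 1, ((e.symm.trans σ).trans e) (φ (e a)) = φ (e b) →
      ((((e.trans φ).trans e.symm).trans σ).trans ((e.trans φ).trans e.symm).symm) a = b := by
    intro a b h
    simp only [AlgEquiv.trans_apply] at h
    simp only [AlgEquiv.trans_apply, AlgEquiv.symm_trans_apply, AlgEquiv.symm_symm, h,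
      AlgEquiv.symm_apply_apply]
  generalize (e.symm.trans σ).trans e = s at *
  rcases hφ with ⟨h, h'⟩ | ⟨h, h'⟩ | ⟨h, h'⟩
  · left
    constructor <;> apply red <;>
      simp only [ex, ey, map_neg, map_smul, map_add, map_sub, h, h', ← smul_neg] <;> congr 1 <;> ring
  · right; left
    constructor <;> apply red <;>
      simp only [ex, ey, map_neg, map_smul, map_add, map_sub, h, h', ← smul_neg] <;> congr 1 <;> ring
  · right; right
    constructor <;> apply red <;>
      simp only [ex, ey, map_neg, map_smul, map_add, map_sub, h, h', ← smul_neg] <;> congr 1 <;> ring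
end
end
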